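/- arXiv:1306.5729 — 2 statements merged into one kernel-verified Lean document; each statement's English description precedes it below -/
import Mathlib

section
/- There exist universal constants c, γ > 0 such that the following holds. Let n ≥ 2, q = (n+1)(n+2)/2, and let f : ℝ^n → ℝ be twice continuously differentiable with Lipschitz continuous Hessian on an open set containing B_∞(x₀;Δ). Fix x₀ ∈ ℝ^n, Δ > 0, h ∈ {1, …, n(n+1)/2}, and constants κ'_ef, κ'_eg, κ'_eh > 0, and assume there exists a quadratic polynomial m(x) = Σ_ι α_ι ψ_ι(x − x₀), with h-sparse quadratic-part coefficient vector α_Q, such that for all x ∈ B_∞(x₀;Δ): |f(x) − m(x)| ≤ κ'_ef Δ³, ‖∇f(x) − ∇m(x)‖₂ ≤ κ'_eg Δ², and ‖∇²f(x) − ∇²m(x)‖₂ ≤ κ'_eh Δ. Then there exist constants κ_ef, κ_eg, κ_eh > 0, depending only on n, h, κ'_ef, κ'_eg, κ'_eh and universal constants (but not on x₀ or Δ), such that if p / log p ≥ 9c·(h+n+1)·(log(h+n+1))²·log q, then with probability at least 1 − n^{−γ log p} over Y = (y¹, …, y^p) drawn according to μ^{⊗p} (μ uniform on B_∞(0;Δ)),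 every minimizer α* of ‖α_Q‖₁ over {α ∈ ℝ^q : ‖M(ψ,Y)α − f(Y + x₀)‖₂ ≤ √p·κ'_ef·Δ³} — where f(Y + x₀) = (f(y¹+x₀), …, f(y^p+x₀)) and [M(ψ,Y)]_{ij} = ψ_j(y^i) — yields a quadratic m*(x) = Σ_ι α*_ι ψ_ι(x − x₀) satisfying, for all x ∈ B_∞(x₀;Δ): |f(x) − m*(x)| ≤ κ_ef Δ³, ‖∇f(x) − ∇m*(x)‖₂ ≤ κ_eg Δ², and ‖∇²f(x) − ∇²m*(x)‖₂ ≤ κ_eh Δ. -/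
open Matrix BigOperators MeasureTheory

/-- The Euclidean (`ℓ₂`) norm of a finitely-indexed real vector. -/
noncomputable def l2 {ι : Type*} [Fintype ι] (v : ι → ℝ) : ℝ := Real.sqrt (∑ i, v i ^ 2)

/-- The `ℓ₁` norm of a finitely-indexed real vector. -/
noncomputable def l1 {ι : Type*} [Fintype ι] (v : ι → ℝ) : ℝ := ∑ i, |v i|

/-- `card' v` is the number of nonzero entries of `v`. -/
noncomputable def card' {ι : Type*} (v : ι → ℝ) : ℕ := Nat.card {i : ι // v i ≠ 0}

/-- `v` is `s`-sparse if it has at most `s` nonzero entries. -/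
def Sparse {ι : Type*} (s : ℕ) (v : ι → ℝ) : Prop := card' v ≤ s

/-- `A` satisfies the Restricted Isometry Property of order `s` with constant `δ`:
`(1 - δ)‖z‖₂² ≤ ‖Az‖₂² ≤ (1 + δ)‖z‖₂²` for every `s`-sparse vector `z`. -/
def RIP {k : ℕ} {ι : Type*} [Fintype ι] (s : ℕ) (δ : ℝ) (A : Matrix (Fin k) ι ℝ) : Prop :=
  ∀ z : ι → ℝ, Sparse s z →
    (1 - δ) * l2 z ^ 2 ≤ l2 (A.mulVec z) ^ 2 ∧ l2 (A.mulVec z) ^ 2 ≤ (1 + δ) * l2 z ^ 2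

/-- Index set for the degree-2 "off-diagonal" basis elements: pairs `i < j`. -/
abbrev Pairs (n : ℕ) := {p : Fin n × Fin n // p.1 < p.2}

/-- Index set for the quadratic part `ψ_Q` of the basis: diagonal terms and pairs `i < j`. -/
abbrev QIdx (n : ℕ) := Fin n ⊕ Pairs n

/-- Index set for the affine part `ψ_L` of the basis: linear terms and the constant term. -/
abbrev LIdx (n : ℕ) := Fin n ⊕ Unit

/-- Index set for the whole basis `ψ`, of cardinality `(n+1)(n+2)/2`. -/
abbrev Idx (n : ℕ) := QIdx n ⊕ LIdx n

/-- The orthonormal quadratic basis `ψ` on the hypercube `[−Δ,Δ]^n`: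
`ψ_{2,i}(x) = (3√5/(2Δ²))x_i² − √5/2`, `ψ_{2,ij}(x) = (3/Δ²)x_i x_j` (`i < j`),
`ψ_{1,i}(x) = (√3/Δ)x_i`, and `ψ_0(x) = 1`. -/
noncomputable def psi (n : ℕ) (Δ : ℝ) : Idx n → (Fin n → ℝ) → ℝ
  | Sum.inl (Sum.inl i) => fun x => 3 * Real.sqrt 5 / (2 * Δ ^ 2) * x i ^ 2 - Real.sqrt 5 / 2
  | Sum.inl (Sum.inr p) => fun x => 3 / Δ ^ 2 * (x p.1.1 * x p.1.2)
  | Sum.inr (Sum.inl i) => fun x => Real.sqrt 3 / Δ * x i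
  | Sum.inr (Sum.inr _) => fun _ => 1

/-- The hypercube `B_∞(0;Δ) = [−Δ,Δ]^n`. -/
def cube (n : ℕ) (Δ : ℝ) : Set (Fin n → ℝ) := {x | ∀ i, |x i| ≤ Δ}

/-- The uniform probability measure `μ` on the hypercube `[−Δ,Δ]^n`. -/
noncomputable def mu (n : ℕ) (Δ : ℝ) : MeasureTheory.Measure (Fin n → ℝ) :=
  (ENNReal.ofReal ((2 * Δ) ^ n))⁻¹ •
    MeasureTheory.Measure.pi (fun _ : Fin n => MeasureTheory.volume.restrict (Set.Icc (-Δ) Δ))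

/-- The gradient of `f : ℝ^n → ℝ` at `x`, as the vector of partial derivatives. -/
noncomputable def grad {n : ℕ} (f : (Fin n → ℝ) → ℝ) (x : Fin n → ℝ) : Fin n → ℝ :=
  fun i => fderiv ℝ f x (Pi.single i 1)

/-- The Hessian of `f : ℝ^n → ℝ` at `x`, as the matrix of second partial derivatives. -/
noncomputable def hess {n : ℕ} (f : (Fin n → ℝ) → ℝ) (x : Fin n → ℝ) :
    Matrix (Fin n) (Fin n) ℝ :=
  fun i j => fderiv ℝ (fun y => fderiv ℝ f y (Pi.single j 1)) x (Pi.single i 1)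

/-- The spectral norm (`ℓ₂`-operator norm) of a matrix. -/
noncomputable def specNorm {n : ℕ} (H : Matrix (Fin n) (Fin n) ℝ) : ℝ :=
  sSup ((fun v => l2 (H.mulVec v)) '' {v | l2 v ≤ 1})

/-- `m` is a fully quadratic model of `f` on `B_∞(x₀;Δ)` with constants `κef, κeg, κeh`. -/
def FullyQuadraticOn {n : ℕ} (f m : (Fin n → ℝ) → ℝ) (x₀ : Fin n → ℝ) (Δ : ℝ)
    (κef κeg κeh : ℝ) : Prop :=
  ∀ x : Fin n → ℝ, x - x₀ ∈ cube n Δ →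
    |f x - m x| ≤ κef * Δ ^ 3 ∧
    l2 (grad f x - grad m x) ≤ κeg * Δ ^ 2 ∧
    specNorm (hess f x - hess m x) ≤ κeh * Δ


/-! ### The one-dimensional uniform measure -/

/-- Uniform probability measure on `[-Δ, Δ]`. -/
noncomputable def nuU (Δ : ℝ) : Measure ℝ :=
  (ENNReal.ofReal (2 * Δ))⁻¹ • volume.restrict (Set.Icc (-Δ) Δ)

lemma nuU_prob {Δ : ℝ} (hΔ : 0 < Δ) : IsProbabilityMeasure (nuU Δ) := by
  constructor
  unfold nuU
  rw [Measure.smul_apply, Measure.restrict_apply_univ, Real.volume_Icc, smul_eq_mul]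
  rw [show Δ - -Δ = 2 * Δ by ring]
  exact ENNReal.inv_mul_cancel (by simpa using hΔ) ENNReal.ofReal_ne_top

lemma mu_eq_pi (n : ℕ) {Δ : ℝ} (hΔ : 0 < Δ) : mu n Δ = Measure.pi (fun _ : Fin n => nuU Δ) := by
  have := nuU_prob hΔ
  symm
  apply Measure.pi_eq
  intro s hs
  unfold mu nuU
  rw [Measure.smul_apply, Measure.pi_pi]
  simp only [Measure.smul_apply, smul_eq_mul]
  rw [Finset.prod_mul_distrib, Finset.prod_const, Finset.card_univ, Fintype.card_fin,
    ENNReal.ofReal_pow (by positivity), ENNReal.inv_pow]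

lemma mu_prob (n : ℕ) {Δ : ℝ} (hΔ : 0 < Δ) : IsProbabilityMeasure (mu n Δ) := by
  have := nuU_prob hΔ
  rw [mu_eq_pi n hΔ]
  infer_instance

lemma mu_ae_cube (n : ℕ) {Δ : ℝ} (hΔ : 0 < Δ) : ∀ᵐ x ∂(mu n Δ), x ∈ cube n Δ := by
  have := nuU_prob hΔ
  rw [mu_eq_pi n hΔ]
  have h1 : ∀ᵐ t ∂(nuU Δ), |t| ≤ Δ := by
    unfold nuU
    apply Measure.ae_smul_measure
    filter_upwards [ae_restrict_mem measurableSet_Icc] with t ht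
    exact abs_le.mpr ht
  have : ∀ i : Fin n, ∀ᵐ x ∂(Measure.pi (fun _ : Fin n => nuU Δ)), |x i| ≤ Δ := by
    intro i
    exact (Measure.quasiMeasurePreserving_eval (fun _ : Fin n => nuU Δ) i).ae h1
  exact ae_all_iff.mpr this

lemma cube_compact (n : ℕ) (Δ : ℝ) : IsCompact (cube n Δ) := by
  have : cube n Δ = Set.univ.pi (fun _ => Set.Icc (-Δ) Δ) := by
    ext x
    simp only [cube, Set.mem_ofPred_eq, Set.mem_pi, Set.mem_univ, true_implies, Set.mem_Icc, abs_le]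
  rw [this]
  exact isCompact_univ_pi (fun _ => isCompact_Icc)

lemma cont_int {n : ℕ} {Δ : ℝ} (hΔ : 0 < Δ) {F : (Fin n → ℝ) → ℝ} (hF : Continuous F) :
    Integrable F (mu n Δ) := by
  have := mu_prob n hΔ
  have h := hF.continuousOn.integrableOn_compact (μ := mu n Δ) (cube_compact n Δ)
  rwa [IntegrableOn, Measure.restrict_eq_self_of_ae_mem (mu_ae_cube n hΔ)] at h

/-- Factorisation: a function not depending on coordinate `k` is independent of coordinate `k`. -/
lemma int_factor {n : ℕ} {Δ : ℝ} (hΔ : 0 < Δ) (k : Fin n) (G : (Fin n → ℝ) → ℝ)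
    (hG : ∀ x y : Fin n → ℝ, (∀ j, j ≠ k → x j = y j) → G x = G y) (u : ℝ → ℝ) :
    ∫ x, G x * u (x k) ∂(mu n Δ) = (∫ x, G x ∂(mu n Δ)) * ∫ t, u t ∂(nuU Δ) := by
  have := nuU_prob hΔ
  rw [mu_eq_pi n hΔ]
  obtain ⟨m, rfl⟩ : ∃ m, n = m + 1 := ⟨n - 1, by have := k.2; omega⟩
  have mp := measurePreserving_piFinSuccAbove (fun _ : Fin (m + 1) => nuU Δ) k
  have hG' : ∀ x : Fin (m + 1) → ℝ, G x = G (k.insertNth 0 (fun j => x (k.succAbove j))) := by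
    intro x
    apply hG
    intro j hj
    obtain ⟨i, rfl⟩ := Fin.exists_succAbove_eq hj
    simp
  have key : ∀ w : ℝ → ℝ, ∫ x, G x * w (x k) ∂(Measure.pi (fun _ : Fin (m + 1) => nuU Δ)) =
      (∫ t, w t ∂(nuU Δ)) * ∫ y, G (k.insertNth 0 y) ∂(Measure.pi (fun _ : Fin m => nuU Δ)) := by
    intro w
    rw [← integral_prod_mul, ← mp.integral_comp']
    apply integral_congr_ae
    filter_upwards with x
    rw [hG' x, mul_comm]
    rfl
  have h1 := key (fun _ => 1)
  simp only [mul_one, integral_const, probReal_univ, smul_eq_mul, one_mul] at h1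
  rw [key u, h1, mul_comm]

lemma nuU_int {Δ : ℝ} (hΔ : 0 < Δ) (u : ℝ → ℝ) :
    ∫ t, u t ∂(nuU Δ) = (2 * Δ)⁻¹ * ∫ t in (-Δ)..Δ, u t := by
  unfold nuU
  rw [integral_smul_measure, integral_Icc_eq_integral_Ioc,
    ← intervalIntegral.integral_of_le (by linarith), ENNReal.toReal_inv,
    ENNReal.toReal_ofReal (by positivity), smul_eq_mul]

/-- Normalised linear polynomial. -/
noncomputable def ph1 (Δ t : ℝ) : ℝ := Real.sqrt 3 / Δ * t
/-- Normalised quadratic polynomial. -/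
noncomputable def ph2 (Δ t : ℝ) : ℝ := 3 * Real.sqrt 5 / (2 * Δ ^ 2) * t ^ 2 - Real.sqrt 5 / 2

lemma ph1_cont (Δ : ℝ) : Continuous (ph1 Δ) := by unfold ph1; fun_prop
lemma ph2_cont (Δ : ℝ) : Continuous (ph2 Δ) := by unfold ph2; fun_prop

lemma poly_int (Δ a b c d e : ℝ) :
    ∫ t in (-Δ)..Δ, (a + b * t + c * t ^ 2 + d * t ^ 3 + e * t ^ 4) =
      2 * a * Δ + 2 * c * Δ ^ 3 / 3 + 2 * e * Δ ^ 5 / 5 := by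
  have i0 : IntervalIntegrable (fun t : ℝ => a) volume (-Δ) Δ :=
    (by fun_prop : Continuous (fun t : ℝ => a)).intervalIntegrable _ _
  have i1 : IntervalIntegrable (fun t : ℝ => b * t) volume (-Δ) Δ :=
    (by fun_prop : Continuous (fun t : ℝ => b * t)).intervalIntegrable _ _
  have i2 : IntervalIntegrable (fun t : ℝ => c * t ^ 2) volume (-Δ) Δ :=
    (by fun_prop : Continuous (fun t : ℝ => c * t ^ 2)).intervalIntegrable _ _
  have i3 : IntervalIntegrable (fun t : ℝ => d * t ^ 3) volume (-Δ) Δ :=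
    (by fun_prop : Continuous (fun t : ℝ => d * t ^ 3)).intervalIntegrable _ _
  have i4 : IntervalIntegrable (fun t : ℝ => e * t ^ 4) volume (-Δ) Δ :=
    (by fun_prop : Continuous (fun t : ℝ => e * t ^ 4)).intervalIntegrable _ _
  rw [intervalIntegral.integral_add (((i0.add i1).add i2).add i3) i4,
    intervalIntegral.integral_add ((i0.add i1).add i2) i3,
    intervalIntegral.integral_add (i0.add i1) i2,
    intervalIntegral.integral_add i0 i1]
  have hb : ∫ t in (-Δ)..Δ, b * t = 0 := by
    rw [intervalIntegral.integral_const_mul, integral_id]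
    ring
  rw [hb]
  simp only [intervalIntegral.integral_const_mul, integral_pow,
    intervalIntegral.integral_const, smul_eq_mul]
  push_cast
  ring

lemma ph1_mean {Δ : ℝ} (hΔ : 0 < Δ) : ∫ t, ph1 Δ t ∂(nuU Δ) = 0 := by
  rw [nuU_int hΔ]
  have := poly_int Δ 0 (Real.sqrt 3 / Δ) 0 0 0
  simp only [zero_add, add_zero, zero_mul, mul_zero, zero_div] at this
  unfold ph1
  rw [this, mul_zero]

lemma ph1_sq {Δ : ℝ} (hΔ : 0 < Δ) : ∫ t, ph1 Δ t ^ 2 ∂(nuU Δ) = 1 := by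
  rw [nuU_int hΔ]
  have := poly_int Δ 0 0 (3 / Δ ^ 2) 0 0
  rw [show (fun t => ph1 Δ t ^ 2) =
    fun t => (0 + 0 * t + (3 / Δ ^ 2) * t ^ 2 + 0 * t ^ 3 + 0 * t ^ 4) from ?_, this]
  · field_simp
    ring
  · funext t
    have h3 : Real.sqrt 3 ^ 2 = 3 := Real.sq_sqrt (by norm_num)
    unfold ph1
    rw [mul_pow, div_pow, h3]
    ring

lemma ph2_mean {Δ : ℝ} (hΔ : 0 < Δ) : ∫ t, ph2 Δ t ∂(nuU Δ) = 0 := by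
  rw [nuU_int hΔ]
  have := poly_int Δ (-(Real.sqrt 5 / 2)) 0 (3 * Real.sqrt 5 / (2 * Δ ^ 2)) 0 0
  rw [show (ph2 Δ) = fun t => (-(Real.sqrt 5 / 2) + 0 * t + (3 * Real.sqrt 5 / (2 * Δ ^ 2)) * t ^ 2
    + 0 * t ^ 3 + 0 * t ^ 4) from ?_, this]
  · field_simp
    ring
  · funext t
    unfold ph2
    ring

lemma ph12_mean {Δ : ℝ} (hΔ : 0 < Δ) : ∫ t, ph1 Δ t * ph2 Δ t ∂(nuU Δ) = 0 := by
  rw [nuU_int hΔ]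
  have := poly_int Δ 0 (-(Real.sqrt 3 / Δ * (Real.sqrt 5 / 2))) 0
    (Real.sqrt 3 / Δ * (3 * Real.sqrt 5 / (2 * Δ ^ 2))) 0
  rw [show (fun t => ph1 Δ t * ph2 Δ t) = fun t =>
    (0 + (-(Real.sqrt 3 / Δ * (Real.sqrt 5 / 2))) * t + 0 * t ^ 2
    + (Real.sqrt 3 / Δ * (3 * Real.sqrt 5 / (2 * Δ ^ 2))) * t ^ 3 + 0 * t ^ 4) from ?_, this]
  · ring
  · funext t
    unfold ph2 ph1
    ring

lemma ph2_sq {Δ : ℝ} (hΔ : 0 < Δ) : ∫ t, ph2 Δ t ^ 2 ∂(nuU Δ) = 1 := by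
  rw [nuU_int hΔ]
  have := poly_int Δ (5 / 4) 0 (- (15 / (2 * Δ ^ 2))) 0 (45 / (4 * Δ ^ 4))
  rw [show (fun t => ph2 Δ t ^ 2) = fun t => (5 / 4 + 0 * t + (- (15 / (2 * Δ ^ 2))) * t ^ 2
    + 0 * t ^ 3 + (45 / (4 * Δ ^ 4)) * t ^ 4) from ?_, this]
  · field_simp
    ring
  · funext t
    have h5 : Real.sqrt 5 ^ 2 = 5 := Real.sq_sqrt (by norm_num)
    unfold ph2
    field_simp
    ring_nf
    rw [h5]
    ring

lemma ph1_bd {Δ t : ℝ} (hΔ : 0 < Δ) (ht : |t| ≤ Δ) : ph1 Δ t ^ 2 ≤ 3 := by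
  have h3 : Real.sqrt 3 ^ 2 = 3 := Real.sq_sqrt (by norm_num)
  unfold ph1
  have h2 : t ^ 2 ≤ Δ ^ 2 := sq_le_sq' (abs_le.mp ht).1 (abs_le.mp ht).2
  rw [mul_pow, div_pow, h3, div_mul_eq_mul_div, div_le_iff₀ (by positivity)]
  linarith

lemma ph2_bd {Δ t : ℝ} (hΔ : 0 < Δ) (ht : |t| ≤ Δ) : ph2 Δ t ^ 2 ≤ 5 := by
  have h5 : Real.sqrt 5 ^ 2 = 5 := Real.sq_sqrt (by norm_num)
  have h2 : t ^ 2 ≤ Δ ^ 2 := sq_le_sq' (abs_le.mp ht).1 (abs_le.mp ht).2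
  have e : ph2 Δ t = Real.sqrt 5 / 2 * (3 * (t ^ 2 / Δ ^ 2) - 1) := by
    unfold ph2
    field_simp
  have r1 : t ^ 2 / Δ ^ 2 ≤ 1 := by
    rw [div_le_one (by positivity)]
    exact h2
  have r0 : 0 ≤ t ^ 2 / Δ ^ 2 := by positivity
  rw [e, mul_pow, div_pow, h5]
  nlinarith

/-! ### Fourth moments (hypercontractivity) -/

lemma cs_int {n : ℕ} {Δ : ℝ} (hΔ : 0 < Δ) {F g : (Fin n → ℝ) → ℝ} (hF : Continuous F)
    (hg : Continuous g) :
    (∫ x, F x ^ 2 * g x ^ 2 ∂(mu n Δ)) ^ 2 ≤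
      (∫ x, F x ^ 4 ∂(mu n Δ)) * ∫ x, g x ^ 4 ∂(mu n Δ) := by
  have h := discrim_le_zero (a := ∫ x, F x ^ 4 ∂(mu n Δ))
    (b := -2 * ∫ x, F x ^ 2 * g x ^ 2 ∂(mu n Δ)) (c := ∫ x, g x ^ 4 ∂(mu n Δ)) ?_
  · unfold discrim at h
    nlinarith
  · intro t
    have h0 : 0 ≤ ∫ x, (F x ^ 2 * t - g x ^ 2) ^ 2 ∂(mu n Δ) :=
      integral_nonneg (fun x => sq_nonneg _)
    have e : ∫ x, (F x ^ 2 * t - g x ^ 2) ^ 2 ∂(mu n Δ) =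
        ∫ x, ((t * t) * F x ^ 4 + (-2 * t) * (F x ^ 2 * g x ^ 2)) + g x ^ 4 ∂(mu n Δ) := by
      congr 1
      funext x
      ring
    rw [e, integral_add (cont_int hΔ (by fun_prop)) (cont_int hΔ (by fun_prop)),
      integral_add (cont_int hΔ (by fun_prop)) (cont_int hΔ (by fun_prop)),
      integral_const_mul, integral_const_mul] at h0
    linarith

lemma fourth_step {n : ℕ} {Δ : ℝ} (hΔ : 0 < Δ) {F g : (Fin n → ℝ) → ℝ} (hF : Continuous F)
    (hg : Continuous g) {K K' : ℝ} (hK' : 0 ≤ K') (hK : 16 * K' ≤ K)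
    (h3 : ∫ x, F x ^ 3 * g x ∂(mu n Δ) = 0) (h1 : ∫ x, F x * g x ∂(mu n Δ) = 0)
    (hF4 : ∫ x, F x ^ 4 ∂(mu n Δ) ≤ K * (∫ x, F x ^ 2 ∂(mu n Δ)) ^ 2)
    (hg4 : ∫ x, g x ^ 4 ∂(mu n Δ) ≤ K' * (∫ x, g x ^ 2 ∂(mu n Δ)) ^ 2) :
    ∫ x, (F x + g x) ^ 2 ∂(mu n Δ) = ∫ x, F x ^ 2 ∂(mu n Δ) + ∫ x, g x ^ 2 ∂(mu n Δ) ∧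
    ∫ x, (F x + g x) ^ 4 ∂(mu n Δ) ≤ K * (∫ x, (F x + g x) ^ 2 ∂(mu n Δ)) ^ 2 := by
  have hsq : ∫ x, (F x + g x) ^ 2 ∂(mu n Δ) =
      ∫ x, F x ^ 2 ∂(mu n Δ) + ∫ x, g x ^ 2 ∂(mu n Δ) := by
    have e : ∫ x, (F x + g x) ^ 2 ∂(mu n Δ) =
        ∫ x, (F x ^ 2 + 2 * (F x * g x)) + g x ^ 2 ∂(mu n Δ) := by
      congr 1
      funext x
      ring
    rw [e, integral_add (cont_int hΔ (by fun_prop)) (cont_int hΔ (by fun_prop)),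
      integral_add (cont_int hΔ (by fun_prop)) (cont_int hΔ (by fun_prop)),
      integral_const_mul, h1]
    ring
  refine ⟨hsq, ?_⟩
  rw [hsq]
  have hle : ∫ x, (F x + g x) ^ 4 ∂(mu n Δ) ≤
      ∫ x, ((F x ^ 4 + 4 * (F x ^ 3 * g x)) + 8 * (F x ^ 2 * g x ^ 2)) + 3 * g x ^ 4
        ∂(mu n Δ) := by
    apply integral_mono (cont_int hΔ (by fun_prop)) (cont_int hΔ (by fun_prop))
    intro x
    have : 0 ≤ 2 * (F x * g x - g x ^ 2) ^ 2 := by positivity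
    simp only
    nlinarith
  rw [integral_add (cont_int hΔ (by fun_prop)) (cont_int hΔ (by fun_prop)),
    integral_add (cont_int hΔ (by fun_prop)) (cont_int hΔ (by fun_prop)),
    integral_add (cont_int hΔ (by fun_prop)) (cont_int hΔ (by fun_prop)),
    integral_const_mul, integral_const_mul, integral_const_mul, h3] at hle
  have hcs := cs_int hΔ hF hg
  have hA : 0 ≤ ∫ x, F x ^ 2 ∂(mu n Δ) := integral_nonneg (fun x => sq_nonneg _)
  have hB : 0 ≤ ∫ x, g x ^ 2 ∂(mu n Δ) := integral_nonneg (fun x => sq_nonneg _)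
  have hg0 : 0 ≤ ∫ x, g x ^ 4 ∂(mu n Δ) := integral_nonneg (fun x => by positivity)
  set A := ∫ x, F x ^ 2 ∂(mu n Δ)
  set B := ∫ x, g x ^ 2 ∂(mu n Δ)
  set C := ∫ x, F x ^ 2 * g x ^ 2 ∂(mu n Δ)
  have hK0 : 0 ≤ K := by linarith
  have hC : C ≤ K * A * B / 4 := by
    refine (le_abs_self _).trans (abs_le_of_sq_le_sq ?_ (by positivity))
    calc C ^ 2 ≤ (K * A ^ 2) * (K' * B ^ 2) := by
          refine hcs.trans ?_
          exact mul_le_mul hF4 hg4 hg0 (by positivity)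
      _ ≤ (K * A ^ 2) * (K / 16 * B ^ 2) := by
          gcongr
          linarith
      _ = (K * A * B / 4) ^ 2 := by ring
  have hKB : 16 * K' * B ^ 2 ≤ K * B ^ 2 := by gcongr
  have : 0 ≤ K' * B ^ 2 := by positivity
  nlinarith

/-- affine functions in the coordinates of `S` -/
lemma affine_moments {n : ℕ} {Δ : ℝ} (hΔ : 0 < Δ) (b : ℝ) (c : Fin n → ℝ) (S : Finset (Fin n)) :
    ∫ x, (b + ∑ j ∈ S, c j * ph1 Δ (x j)) ^ 2 ∂(mu n Δ) = b ^ 2 + ∑ j ∈ S, c j ^ 2 ∧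
    ∫ x, (b + ∑ j ∈ S, c j * ph1 Δ (x j)) ^ 4 ∂(mu n Δ) ≤
      144 * (∫ x, (b + ∑ j ∈ S, c j * ph1 Δ (x j)) ^ 2 ∂(mu n Δ)) ^ 2 := by
  have := mu_prob n hΔ
  have hph := ph1_cont Δ
  induction S using Finset.induction_on with
  | empty =>
    simp
    nlinarith [sq_nonneg (b ^ 2)]
  | insert k S hk ih =>
    have e : ∀ x : Fin n → ℝ, b + ∑ j ∈ insert k S, c j * ph1 Δ (x j) =
        (b + ∑ j ∈ S, c j * ph1 Δ (x j)) + c k * ph1 Δ (x k) := by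
      intro x
      rw [Finset.sum_insert hk]
      ring
    simp only [e]
    have hdep : ∀ x y : Fin n → ℝ, (∀ j, j ≠ k → x j = y j) →
        b + ∑ j ∈ S, c j * ph1 Δ (x j) = b + ∑ j ∈ S, c j * ph1 Δ (y j) := by
      intro x y hxy
      congr 1
      apply Finset.sum_congr rfl
      intro j hj
      rw [hxy j (fun h => hk (h ▸ hj))]
    have horth : ∀ m : ℕ, ∫ x : Fin n → ℝ, (b + ∑ j ∈ S, c j * ph1 Δ (x j)) ^ m *
        (c k * ph1 Δ (x k)) ∂(mu n Δ) = 0 := by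
      intro m
      have h := int_factor hΔ k (fun x => (b + ∑ j ∈ S, c j * ph1 Δ (x j)) ^ m)
        (fun x y hxy => by simp only [hdep x y hxy]) (fun t => c k * ph1 Δ t)
      rw [h, integral_const_mul, ph1_mean hΔ]
      ring
    have hg2 : ∫ x : Fin n → ℝ, (c k * ph1 Δ (x k)) ^ 2 ∂(mu n Δ) = c k ^ 2 := by
      have h := int_factor hΔ k (fun _ => c k ^ 2) (fun _ _ _ => rfl) (fun t => ph1 Δ t ^ 2)
      simp only [mul_pow]
      rw [h, ph1_sq hΔ]
      simp
    have hg4 : ∫ x : Fin n → ℝ, (c k * ph1 Δ (x k)) ^ 4 ∂(mu n Δ) ≤ 9 * (c k ^ 2) ^ 2 := by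
      have : ∫ x : Fin n → ℝ, (c k * ph1 Δ (x k)) ^ 4 ∂(mu n Δ) ≤
          ∫ x : Fin n → ℝ, 9 * (c k ^ 2) ^ 2 ∂(mu n Δ) := by
        apply integral_mono_ae (cont_int hΔ (by fun_prop)) (cont_int hΔ (by fun_prop))
        filter_upwards [mu_ae_cube n hΔ] with x hx
        have h1 := ph1_bd hΔ (hx k)
        have h2 : (ph1 Δ (x k) ^ 2) ^ 2 ≤ 3 ^ 2 := by gcongr
        have : (c k * ph1 Δ (x k)) ^ 4 = (c k ^ 2) ^ 2 * (ph1 Δ (x k) ^ 2) ^ 2 := by ring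
        rw [this]
        nlinarith [sq_nonneg (c k ^ 2)]
      simpa using this
    have h1 := horth 1
    simp only [pow_one] at h1
    have := fourth_step hΔ (F := fun x => b + ∑ j ∈ S, c j * ph1 Δ (x j))
      (g := fun x => c k * ph1 Δ (x k)) (by fun_prop) (by fun_prop) (K := 144) (K' := 9)
      (by norm_num) (by norm_num) (horth 3) h1 ih.2 (by rw [hg2]; exact hg4)
    refine ⟨?_, this.2⟩
    rw [this.1, ih.1, hg2, Finset.sum_insert hk]
    ring

/-- The fourth-moment constant. -/
def KK : ℝ := 464000

lemma quad_moments {n : ℕ} {Δ : ℝ} (hΔ : 0 < Δ) (z0 : ℝ) (b d : Fin n → ℝ)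
    (c : Fin n → Fin n → ℝ) (S : Finset (Fin n)) :
    ∫ x, (z0 + ∑ i ∈ S, (ph1 Δ (x i) * (b i + ∑ j ∈ Finset.univ.filter (· < i),
      c i j * ph1 Δ (x j)) + d i * ph2 Δ (x i))) ^ 2 ∂(mu n Δ) =
      z0 ^ 2 + ∑ i ∈ S, (b i ^ 2 + (∑ j ∈ Finset.univ.filter (· < i), c i j ^ 2) + d i ^ 2) ∧
    ∫ x, (z0 + ∑ i ∈ S, (ph1 Δ (x i) * (b i + ∑ j ∈ Finset.univ.filter (· < i),
      c i j * ph1 Δ (x j)) + d i * ph2 Δ (x i))) ^ 4 ∂(mu n Δ) ≤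
      KK * (∫ x, (z0 + ∑ i ∈ S, (ph1 Δ (x i) * (b i + ∑ j ∈ Finset.univ.filter (· < i),
      c i j * ph1 Δ (x j)) + d i * ph2 Δ (x i))) ^ 2 ∂(mu n Δ)) ^ 2 := by
  have := mu_prob n hΔ
  have hph := ph1_cont Δ
  have hph2 := ph2_cont Δ
  induction S using Finset.induction_on_max with
  | empty =>
    simp [KK]
    nlinarith [sq_nonneg (z0 ^ 2)]
  | insert k S hk ih =>
    have hkS : k ∉ S := fun h => lt_irrefl _ (hk k h)
    set B : (Fin n → ℝ) → ℝ := fun x => b k + ∑ j ∈ Finset.univ.filter (· < k),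
      c k j * ph1 Δ (x j) with hB
    set F : (Fin n → ℝ) → ℝ := fun x => z0 + ∑ i ∈ S, (ph1 Δ (x i) *
      (b i + ∑ j ∈ Finset.univ.filter (· < i), c i j * ph1 Δ (x j)) + d i * ph2 Δ (x i)) with hF
    have hBc : Continuous B := by simp only [hB]; fun_prop
    have hFc : Continuous F := by simp only [hF]; fun_prop
    have e : ∀ x : Fin n → ℝ, z0 + ∑ i ∈ insert k S, (ph1 Δ (x i) *
      (b i + ∑ j ∈ Finset.univ.filter (· < i), c i j * ph1 Δ (x j)) + d i * ph2 Δ (x i)) =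
        F x + (ph1 Δ (x k) * B x + d k * ph2 Δ (x k)) := by
      intro x
      rw [Finset.sum_insert hkS]
      simp only [hF, hB]
      ring
    simp only [e]
    have hBdep : ∀ x y : Fin n → ℝ, (∀ j, j ≠ k → x j = y j) → B x = B y := by
      intro x y hxy
      simp only [hB]
      congr 1
      apply Finset.sum_congr rfl
      intro j hj
      rw [hxy j (Finset.mem_filter.mp hj).2.ne]
    have hFdep : ∀ x y : Fin n → ℝ, (∀ j, j ≠ k → x j = y j) → F x = F y := by
      intro x y hxy
      simp only [hF]
      congr 1
      apply Finset.sum_congr rfl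
      intro i hi
      have hik := hk i hi
      rw [hxy i hik.ne]
      congr 3
      apply Finset.sum_congr rfl
      intro j hj
      rw [hxy j ((Finset.mem_filter.mp hj).2.trans hik).ne]
    have horth : ∀ m : ℕ, ∫ x : Fin n → ℝ, F x ^ m *
        (ph1 Δ (x k) * B x + d k * ph2 Δ (x k)) ∂(mu n Δ) = 0 := by
      intro m
      have h1 := int_factor hΔ k (fun x => F x ^ m * B x)
        (fun x y hxy => by simp only [hFdep x y hxy, hBdep x y hxy]) (fun t => ph1 Δ t)
      have h2 := int_factor hΔ k (fun x => F x ^ m)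
        (fun x y hxy => by simp only [hFdep x y hxy]) (fun t => d k * ph2 Δ t)
      rw [ph1_mean hΔ, mul_zero] at h1
      rw [integral_const_mul, ph2_mean hΔ, mul_zero, mul_zero] at h2
      have e2 : ∀ x : Fin n → ℝ, F x ^ m * (ph1 Δ (x k) * B x + d k * ph2 Δ (x k)) =
        F x ^ m * B x * ph1 Δ (x k) + F x ^ m * (d k * ph2 Δ (x k)) := fun x => by ring
      simp only [e2]
      rw [integral_add (cont_int hΔ (by fun_prop)) (cont_int hΔ (by fun_prop)), h1, h2, add_zero]
    obtain ⟨hB2, hB4⟩ := affine_moments hΔ (b k) (c k) (Finset.univ.filter (· < k))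
    have hg2 : ∫ x : Fin n → ℝ, (ph1 Δ (x k) * B x + d k * ph2 Δ (x k)) ^ 2 ∂(mu n Δ) =
        ∫ x, B x ^ 2 ∂(mu n Δ) + d k ^ 2 := by
      have h1 := int_factor hΔ k (fun x => B x ^ 2)
        (fun x y hxy => by simp only [hBdep x y hxy]) (fun t => ph1 Δ t ^ 2)
      have h2 := int_factor hΔ k (fun x => 2 * d k * B x)
        (fun x y hxy => by simp only [hBdep x y hxy]) (fun t => ph1 Δ t * ph2 Δ t)
      have h3 := int_factor hΔ k (fun _ => d k ^ 2) (fun _ _ _ => rfl) (fun t => ph2 Δ t ^ 2)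
      rw [ph1_sq hΔ, mul_one] at h1
      rw [ph12_mean hΔ, mul_zero] at h2
      rw [ph2_sq hΔ, mul_one] at h3
      have e2 : ∀ x : Fin n → ℝ, (ph1 Δ (x k) * B x + d k * ph2 Δ (x k)) ^ 2 =
        (B x ^ 2 * ph1 Δ (x k) ^ 2 + 2 * d k * B x * (ph1 Δ (x k) * ph2 Δ (x k))) +
          d k ^ 2 * ph2 Δ (x k) ^ 2 := fun x => by ring
      simp only [e2]
      rw [integral_add (cont_int hΔ (by fun_prop)) (cont_int hΔ (by fun_prop)),
        integral_add (cont_int hΔ (by fun_prop)) (cont_int hΔ (by fun_prop)), h1, h2, h3]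
      simp
    have hg4 : ∫ x : Fin n → ℝ, (ph1 Δ (x k) * B x + d k * ph2 Δ (x k)) ^ 4 ∂(mu n Δ) ≤
        29000 * (∫ x, B x ^ 2 ∂(mu n Δ) + d k ^ 2) ^ 2 := by
      have h1 : ∫ x : Fin n → ℝ, (ph1 Δ (x k) * B x + d k * ph2 Δ (x k)) ^ 4 ∂(mu n Δ) ≤
          ∫ x : Fin n → ℝ, (200 * B x ^ 4 + 200 * d k ^ 4) ∂(mu n Δ) := by
        apply integral_mono_ae (cont_int hΔ (by fun_prop)) (cont_int hΔ (by fun_prop))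
        filter_upwards [mu_ae_cube n hΔ] with x hx
        have h1 := ph1_bd hΔ (hx k)
        have h2 := ph2_bd hΔ (hx k)
        have h3 : (ph1 Δ (x k) ^ 2) ^ 2 ≤ 5 ^ 2 := by gcongr; linarith
        have h4 : (ph2 Δ (x k) ^ 2) ^ 2 ≤ 5 ^ 2 := by gcongr
        have h5 : ∀ s t : ℝ, (s + t) ^ 4 ≤ 8 * (s ^ 4 + t ^ 4) := by
          intro s t
          have : (s + t) ^ 2 ≤ 2 * (s ^ 2 + t ^ 2) := by nlinarith [sq_nonneg (s - t)]
          calc (s + t) ^ 4 = ((s + t) ^ 2) ^ 2 := by ring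
            _ ≤ (2 * (s ^ 2 + t ^ 2)) ^ 2 := by gcongr
            _ ≤ 8 * (s ^ 4 + t ^ 4) := by nlinarith [sq_nonneg (s ^ 2 - t ^ 2)]
        refine (h5 _ _).trans ?_
        have e1 : (ph1 Δ (x k) * B x) ^ 4 ≤ 25 * B x ^ 4 := by
          have : (ph1 Δ (x k) * B x) ^ 4 = (ph1 Δ (x k) ^ 2) ^ 2 * B x ^ 4 := by ring
          rw [this]
          gcongr
          linarith
        have e2 : (d k * ph2 Δ (x k)) ^ 4 ≤ 25 * d k ^ 4 := by
          have : (d k * ph2 Δ (x k)) ^ 4 = (ph2 Δ (x k) ^ 2) ^ 2 * d k ^ 4 := by ring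
          rw [this]
          gcongr
          linarith
        linarith
      rw [integral_add (cont_int hΔ (by fun_prop)) (cont_int hΔ (by fun_prop)),
        integral_const_mul] at h1
      simp only [integral_const, probReal_univ, one_smul] at h1
      have hB0 : 0 ≤ ∫ x, B x ^ 2 ∂(mu n Δ) := integral_nonneg (fun x => sq_nonneg _)
      change ∫ x, B x ^ 4 ∂(mu n Δ) ≤ 144 * (∫ x, B x ^ 2 ∂(mu n Δ)) ^ 2 at hB4
      have : 0 ≤ (∫ x, B x ^ 2 ∂(mu n Δ)) * d k ^ 2 := by positivity
      nlinarith [sq_nonneg (∫ x, B x ^ 2 ∂(mu n Δ)), sq_nonneg (d k ^ 2)]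
    have h1 := horth 1
    simp only [pow_one] at h1
    have := fourth_step hΔ (F := F)
      (g := fun x => ph1 Δ (x k) * B x + d k * ph2 Δ (x k)) (by fun_prop) (by fun_prop)
      (K := KK) (K' := 29000)
      (by norm_num) (by norm_num [KK]) (horth 3) h1 ih.2 (by rw [hg2]; exact hg4)
    refine ⟨?_, this.2⟩
    rw [this.1, ih.1, hg2, Finset.sum_insert hkS]
    change ∫ x, B x ^ 2 ∂(mu n Δ) = _ at hB2
    rw [hB2]
    ring

/-! ### The polynomial with given coefficients -/

/-- Evaluation of the polynomial with coefficient vector `z`. -/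
noncomputable def ev (n : ℕ) (Δ : ℝ) (z : Idx n → ℝ) (x : Fin n → ℝ) : ℝ :=
  ∑ ι, z ι * psi n Δ ι x

lemma pairs_sum {n : ℕ} (w : Fin n → Fin n → ℝ) :
    ∑ p : Pairs n, w p.1.1 p.1.2 = ∑ i, ∑ j ∈ Finset.univ.filter (· < i), w j i := by
  have h := Finset.sum_subtype (F := inferInstance) (p := fun p : Fin n × Fin n => p.1 < p.2)
    (Finset.univ.filter (fun p : Fin n × Fin n => p.1 < p.2)) (by simp) (fun p => w p.1 p.2)
  rw [← h, Finset.sum_filter, Fintype.sum_prod_type, Finset.sum_comm]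
  simp only [Finset.sum_filter]

/-- Off-diagonal coefficients, extended by zero. -/
noncomputable def offc {n : ℕ} (z : Idx n → ℝ) (i j : Fin n) : ℝ :=
  if h : j < i then z (Sum.inl (Sum.inr ⟨(j, i), h⟩)) else 0

lemma offc_eq {n : ℕ} (z : Idx n → ℝ) (p : Pairs n) :
    offc z p.1.2 p.1.1 = z (Sum.inl (Sum.inr p)) := by
  unfold offc
  rw [dif_pos p.2]

lemma ev_eq {n : ℕ} {Δ : ℝ} (z : Idx n → ℝ) (x : Fin n → ℝ) :
    ev n Δ z x = z (Sum.inr (Sum.inr ())) + ∑ i ∈ Finset.univ, (ph1 Δ (x i) *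
      (z (Sum.inr (Sum.inl i)) + ∑ j ∈ Finset.univ.filter (· < i),
      offc z i j * ph1 Δ (x j)) + z (Sum.inl (Sum.inl i)) * ph2 Δ (x i)) := by
  have hp : ∑ p : Pairs n, z (Sum.inl (Sum.inr p)) * psi n Δ (Sum.inl (Sum.inr p)) x =
      ∑ i, ∑ j ∈ Finset.univ.filter (· < i), offc z i j * (ph1 Δ (x j) * ph1 Δ (x i)) := by
    rw [← pairs_sum (fun j i => offc z i j * (ph1 Δ (x j) * ph1 Δ (x i)))]
    apply Finset.sum_congr rfl
    intro p _
    rw [offc_eq]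
    congr 1
    have h3 : Real.sqrt 3 * Real.sqrt 3 = 3 := Real.mul_self_sqrt (by norm_num)
    simp only [psi, ph1]
    linear_combination (-(x p.1.1 * x p.1.2) / Δ ^ 2) * h3
  unfold ev
  rw [Fintype.sum_sum_type, Fintype.sum_sum_type, Fintype.sum_sum_type, hp]
  simp only [psi, Finset.univ_unique, Finset.sum_singleton, mul_one, Finset.sum_add_distrib,
    mul_add, Finset.mul_sum, PUnit.default_eq_unit]
  have e1 : ∀ i j : Fin n, ph1 Δ (x i) * (offc z i j * ph1 Δ (x j)) =
    offc z i j * (ph1 Δ (x j) * ph1 Δ (x i)) := fun i j => by ring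
  simp only [e1]
  have e2 : ∀ i, ph1 Δ (x i) * z (Sum.inr (Sum.inl i)) =
    z (Sum.inr (Sum.inl i)) * (Real.sqrt 3 / Δ * x i) := fun i => by unfold ph1; ring
  simp only [e2]
  unfold ph2
  ring

lemma ev_norm_eq {n : ℕ} (z : Idx n → ℝ) :
    ∑ ι, z ι ^ 2 = z (Sum.inr (Sum.inr ())) ^ 2 + ∑ i ∈ Finset.univ,
      (z (Sum.inr (Sum.inl i)) ^ 2 + (∑ j ∈ Finset.univ.filter (· < i), offc z i j ^ 2) +
        z (Sum.inl (Sum.inl i)) ^ 2) := by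
  have hp : ∑ p : Pairs n, z (Sum.inl (Sum.inr p)) ^ 2 =
      ∑ i, ∑ j ∈ Finset.univ.filter (· < i), offc z i j ^ 2 := by
    rw [← pairs_sum (fun j i => offc z i j ^ 2)]
    apply Finset.sum_congr rfl
    intro p _
    rw [offc_eq]
  rw [Fintype.sum_sum_type, Fintype.sum_sum_type, Fintype.sum_sum_type, hp]
  simp only [Finset.univ_unique, Finset.sum_singleton, Finset.sum_add_distrib,
    PUnit.default_eq_unit]
  ring

lemma ev_cont {n : ℕ} {Δ : ℝ} (z : Idx n → ℝ) : Continuous (ev n Δ z) := by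
  have hph := ph1_cont Δ
  have hph2 := ph2_cont Δ
  have : ev n Δ z = fun x => _ := funext (fun x => ev_eq z x)
  rw [this]
  fun_prop

lemma ev_moments {n : ℕ} {Δ : ℝ} (hΔ : 0 < Δ) (z : Idx n → ℝ) :
    ∫ x, ev n Δ z x ^ 2 ∂(mu n Δ) = ∑ ι, z ι ^ 2 ∧
    ∫ x, (ev n Δ z x ^ 2) ^ 2 ∂(mu n Δ) ≤ KK * (∫ x, ev n Δ z x ^ 2 ∂(mu n Δ)) ^ 2 := by
  have h := quad_moments hΔ (z (Sum.inr (Sum.inr ()))) (fun i => z (Sum.inr (Sum.inl i)))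
    (fun i => z (Sum.inl (Sum.inl i))) (offc z) Finset.univ
  simp only [← ev_eq] at h
  refine ⟨?_, ?_⟩
  · rw [h.1, ev_norm_eq]
  · simp only [← pow_mul]
    exact h.2

/-! ### Lower-tail concentration -/

lemma exp_neg_bd {t : ℝ} (ht : 0 ≤ t) : Real.exp (-t) ≤ 1 - t + t ^ 2 := by
  rw [Real.exp_neg, inv_le_iff_one_le_mul₀ (Real.exp_pos t)]
  have h := Real.add_one_le_exp t
  have h2 : 0 ≤ 1 - t + t ^ 2 := by nlinarith [sq_nonneg (t - 1 / 2)]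
  calc (1 : ℝ) ≤ (1 - t + t ^ 2) * (t + 1) := by
        have : 0 ≤ t ^ 3 := by positivity
        nlinarith
    _ ≤ _ := by gcongr

lemma lower_tail {X : Type*} [MeasurableSpace X] (μ : Measure X) [IsProbabilityMeasure μ]
    (W : X → ℝ) (hWm : Measurable W) (hW0 : ∀ x, 0 ≤ W x) (hWi : Integrable W μ)
    (hWi2 : Integrable (fun x => W x ^ 2) μ) {K : ℝ} (hK : 0 < K)
    (h2 : ∫ x, W x ^ 2 ∂μ ≤ K * (∫ x, W x ∂μ) ^ 2) (p : ℕ) :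
    (Measure.pi (fun _ : Fin p => μ)).real {Y | ∑ i, W (Y i) < p * (∫ x, W x ∂μ) / 2} ≤
      Real.exp (-(p / (16 * K))) := by
  set A := ∫ x, W x ∂μ with hA
  have hA0 : 0 ≤ A := integral_nonneg hW0
  rcases hA0.eq_or_lt with hA0 | hA0
  · have : {Y : Fin p → X | ∑ i, W (Y i) < p * A / 2} = ∅ := by
      ext Y
      have : 0 ≤ ∑ i, W (Y i) := Finset.sum_nonneg (fun i _ => hW0 _)
      simp [← hA0, this]
    rw [this]
    simp [Real.exp_nonneg]
  set l : ℝ := 1 / (4 * K * A) with hl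
  have hl0 : 0 < l := by positivity
  have hint : Integrable (fun x => Real.exp (-(l * W x))) μ := by
    apply Integrable.of_bound (C := 1)
    · exact (by fun_prop : Measurable fun x => Real.exp (-(l * W x))).aestronglyMeasurable
    · filter_upwards with x
      rw [Real.norm_eq_abs, abs_of_pos (Real.exp_pos _), Real.exp_le_one_iff]
      have := mul_nonneg hl0.le (hW0 x)
      linarith
  have hE : ∫ x, Real.exp (-(l * W x)) ∂μ ≤ Real.exp (-(l * A) + l ^ 2 * (K * A ^ 2)) := by
    calc ∫ x, Real.exp (-(l * W x)) ∂μ ≤ ∫ x, ((1 - l * W x) + l ^ 2 * W x ^ 2) ∂μ := by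
          apply integral_mono hint
          · exact ((integrable_const _).sub (hWi.const_mul l)).add (hWi2.const_mul _)
          · intro x
            have := exp_neg_bd (mul_nonneg hl0.le (hW0 x))
            simp only
            linarith
      _ = 1 - l * A + l ^ 2 * ∫ x, W x ^ 2 ∂μ := by
          have hi1 : Integrable (fun x => 1 - l * W x) μ :=
            (integrable_const _).sub (hWi.const_mul l)
          rw [integral_add hi1 (hWi2.const_mul _),
            integral_sub (integrable_const _) (hWi.const_mul l), integral_const_mul,
            integral_const_mul]
          simp [hA]
      _ ≤ 1 - l * A + l ^ 2 * (K * A ^ 2) := by gcongr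
      _ ≤ _ := by
          have := Real.add_one_le_exp (-(l * A) + l ^ 2 * (K * A ^ 2))
          linarith
  have hprod : ∫ Y : Fin p → X, ∏ i, Real.exp (-(l * W (Y i))) ∂(Measure.pi (fun _ => μ)) ≤
      Real.exp (-(l * A) + l ^ 2 * (K * A ^ 2)) ^ p := by
    rw [integral_fintype_prod_eq_pow (fun x => Real.exp (-(l * W x))), Fintype.card_fin]
    apply pow_le_pow_left₀ _ hE
    exact integral_nonneg (fun x => (Real.exp_pos _).le)
  have hmk := mul_meas_ge_le_integral_of_nonneg (μ := Measure.pi (fun _ : Fin p => μ))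
    (f := fun Y => ∏ i, Real.exp (-(l * W (Y i))))
    (Filter.Eventually.of_forall (fun Y => Finset.prod_nonneg (fun i _ => (Real.exp_pos _).le)))
    (Integrable.fintype_prod (f := fun (_ : Fin p) x => Real.exp (-(l * W x))) (fun _ => hint))
    (Real.exp (-(l * (p * A / 2))))
  have hsub : (Measure.pi (fun _ : Fin p => μ)).real {Y | ∑ i, W (Y i) < p * A / 2} ≤
      (Measure.pi (fun _ : Fin p => μ)).real
        {Y | Real.exp (-(l * (p * A / 2))) ≤ ∏ i, Real.exp (-(l * W (Y i)))} := by
    apply measureReal_mono _ (measure_ne_top _ _)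
    intro Y hY
    simp only [Set.mem_ofPred_eq] at hY ⊢
    rw [← Real.exp_sum, Real.exp_le_exp, Finset.sum_neg_distrib, ← Finset.mul_sum]
    have := mul_le_mul_of_nonneg_left hY.le hl0.le
    linarith
  refine hsub.trans ?_
  have hfin := hmk.trans hprod
  rw [← Real.exp_nat_mul] at hfin
  have : Real.exp (-(p / (16 * K))) = (Real.exp (-(l * (p * A / 2))))⁻¹ *
      Real.exp (p * (-(l * A) + l ^ 2 * (K * A ^ 2))) := by
    rw [← Real.exp_neg, ← Real.exp_add]
    congr 1
    rw [hl]
    field_simp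
    ring
  rw [this, ← div_eq_inv_mul, le_div_iff₀ (Real.exp_pos _), mul_comm]
  exact hfin

/-! ### Maurey's empirical method -/

/-- Sums of signed unit vectors. -/
noncomputable def netvec {I : Type*} [DecidableEq I] {k : ℕ} (t : Fin k → I × Bool) : I → ℝ :=
  ∑ m, Pi.single (t m).1 (if (t m).2 then (1 : ℝ) else -1)

lemma maurey_step {T I : Type*} [Fintype T] [Fintype I] (A : T → I → ℝ)
    (b : ℝ) (hb : ∀ j, ∑ i, A i j ^ 2 ≤ b) (v : I → ℝ) (hv : ∑ j, |v j| = 1) (u : T → ℝ) :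
    ∃ (j : I) (s : Bool), ∑ i, (u i + (if s then (1 : ℝ) else -1) * A i j - ∑ l, v l * A i l) ^ 2 ≤
      ∑ i, u i ^ 2 + b := by
  classical
  by_contra! hcon
  let sg : I → Bool := fun j => decide (0 ≤ v j)
  have hsg : ∀ j, |v j| * (if sg j then (1 : ℝ) else -1) = v j := by
    intro j
    by_cases h : 0 ≤ v j
    · simp [sg, h, abs_of_nonneg h]
    · simp [sg, h, abs_of_neg (not_le.mp h)]
  have hsg2 : ∀ j, (if sg j then (1 : ℝ) else -1) ^ 2 = 1 := by
    intro j
    split_ifs <;> norm_num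
  have h1 : ∑ j, |v j| * (∑ i, u i ^ 2 + b) < ∑ j, |v j| * ∑ i, (u i +
      (if sg j then (1 : ℝ) else -1) * A i j - ∑ l, v l * A i l) ^ 2 := by
    apply Finset.sum_lt_sum
    · intro j _
      exact mul_le_mul_of_nonneg_left (hcon j (sg j)).le (abs_nonneg _)
    · by_contra! h
      have : ∀ j, |v j| ≤ 0 := by
        intro j
        by_contra! h0
        have := h j (Finset.mem_univ j)
        have h2 := mul_lt_mul_of_pos_left (hcon j (sg j)) h0
        linarith
      have h3 : ∑ j, |v j| ≤ 0 := Finset.sum_nonpos (fun j _ => this j)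
      linarith
  rw [← Finset.sum_mul, hv, one_mul] at h1
  have h2 : ∑ j, |v j| * ∑ i, (u i +
      (if sg j then (1 : ℝ) else -1) * A i j - ∑ l, v l * A i l) ^ 2 =
      ∑ i, (u i ^ 2 - (∑ l, v l * A i l) ^ 2) + ∑ j, |v j| * ∑ i, A i j ^ 2 := by
    simp only [Finset.mul_sum]
    rw [Finset.sum_comm, Finset.sum_comm (f := fun j i => |v j| * A i j ^ 2),
      ← Finset.sum_add_distrib]
    apply Finset.sum_congr rfl
    intro i _
    have e : ∀ j, |v j| * (u i + (if sg j then (1 : ℝ) else -1) * A i j - ∑ l, v l * A i l) ^ 2 =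
        |v j| * (u i - ∑ l, v l * A i l) ^ 2 + (v j * A i j) * (2 * (u i - ∑ l, v l * A i l)) +
          |v j| * A i j ^ 2 := by
      intro j
      have a1 := hsg j
      have a2 := hsg2 j
      set σ : ℝ := if sg j then (1 : ℝ) else -1
      linear_combination (2 * (u i - ∑ l, v l * A i l) * A i j) * a1 + |v j| * A i j ^ 2 * a2
    simp only [e]
    rw [Finset.sum_add_distrib, Finset.sum_add_distrib, ← Finset.sum_mul, ← Finset.sum_mul, hv]
    ring
  have h3 : ∑ j, |v j| * ∑ i, A i j ^ 2 ≤ b := by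
    calc ∑ j, |v j| * ∑ i, A i j ^ 2 ≤ ∑ j, |v j| * b := by
          apply Finset.sum_le_sum
          intro j _
          exact mul_le_mul_of_nonneg_left (hb j) (abs_nonneg _)
      _ = b := by rw [← Finset.sum_mul, hv, one_mul]
  have h4 : ∑ i, (u i ^ 2 - (∑ l, v l * A i l) ^ 2) ≤ ∑ i, u i ^ 2 := by
    apply Finset.sum_le_sum
    intro i _
    nlinarith [sq_nonneg (∑ l, v l * A i l)]
  linarith

lemma maurey {T I : Type*} [Fintype T] [Fintype I] [DecidableEq I] (A : T → I → ℝ)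
    (b : ℝ) (hb : ∀ j, ∑ i, A i j ^ 2 ≤ b) (v : I → ℝ) (hv : ∑ j, |v j| = 1) (k : ℕ) :
    ∃ t : Fin k → I × Bool, ∑ i, (∑ j, (netvec t j - k * v j) * A i j) ^ 2 ≤ k * b := by
  induction k with
  | zero => exact ⟨Fin.elim0, by simp [netvec]⟩
  | succ k ih =>
    obtain ⟨t, ht⟩ := ih
    obtain ⟨j, s, hjs⟩ := maurey_step A b hb v hv (fun i => ∑ j, (netvec t j - k * v j) * A i j)
    refine ⟨Fin.cons (j, s) t, ?_⟩
    have hnet : ∀ l, netvec (Fin.cons (j, s) t : Fin (k + 1) → I × Bool) l =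
        (Pi.single j (if s then (1 : ℝ) else -1) : I → ℝ) l + netvec t l := by
      intro l
      simp [netvec, Fin.sum_univ_succ]
    have e : ∀ i, ∑ l, (netvec (Fin.cons (j, s) t : Fin (k + 1) → I × Bool) l -
        ((k + 1 : ℕ) : ℝ) * v l) * A i l = ∑ j, (netvec t j - k * v j) * A i j +
          (if s then (1 : ℝ) else -1) * A i j - ∑ l, v l * A i l := by
      intro i
      have e1 : ∑ l, (Pi.single j (if s then (1 : ℝ) else -1) : I → ℝ) l * A i l =
          (if s then (1 : ℝ) else -1) * A i j := by
        rw [Finset.sum_eq_single j]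
        · simp
        · intro l _ hl
          simp [hl]
        · simp
      rw [← e1, ← Finset.sum_add_distrib, ← Finset.sum_sub_distrib]
      apply Finset.sum_congr rfl
      intro l _
      rw [hnet]
      push_cast
      ring
    simp only [e]
    refine hjs.trans ?_
    push_cast
    linarith

/-- Lower restricted-eigenvalue bound on a cone from the bound on a finite net. -/
lemma cone_bound {I : Type*} [Fintype I] [DecidableEq I] {p s k : ℕ}
    (hk : k = 800 * s) (hs : 0 < s) (a : Fin p → I → ℝ) (ha : ∀ i j, a i j ^ 2 ≤ 9)
    (hnet : ∀ t : Fin k → I × Bool, (p : ℝ) * (∑ j, netvec t j ^ 2) / 2 ≤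
      ∑ i, (∑ j, netvec t j * a i j) ^ 2)
    (v : I → ℝ) (hv : (∑ j, |v j|) ^ 2 ≤ 4 * s * ∑ j, v j ^ 2) :
    (p : ℝ) / 16 * ∑ j, v j ^ 2 ≤ ∑ i, (∑ j, v j * a i j) ^ 2 := by
  set R := ∑ j, |v j| with hR
  have hR0 : 0 ≤ R := Finset.sum_nonneg (fun j _ => abs_nonneg _)
  rcases hR0.eq_or_lt with h0 | h0
  · have hz : ∀ j, v j = 0 := by
      intro j
      have := (Finset.sum_eq_zero_iff_of_nonneg (fun j _ => abs_nonneg (v j))).mp h0.symm j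
        (Finset.mem_univ j)
      exact abs_eq_zero.mp this
    simp [hz]
  set w : I → ℝ := fun j => v j / R with hw
  have hw1 : ∑ j, |w j| = 1 := by
    simp only [hw, abs_div, abs_of_pos h0]
    rw [← Finset.sum_div, ← hR, div_self h0.ne']
  have hvw : ∀ j, v j = R * w j := fun j => by
    simp only [hw]
    field_simp
  let A : Fin p ⊕ I → I → ℝ := fun i j => match i with
    | Sum.inl i => a i j
    | Sum.inr l => if j = l then Real.sqrt p else 0
  have hp0 : (0 : ℝ) ≤ p := Nat.cast_nonneg p
  have hA : ∀ j, ∑ i, A i j ^ 2 ≤ 10 * p := by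
    intro j
    rw [Fintype.sum_sum_type]
    have h1 : ∑ i, A (Sum.inl i) j ^ 2 ≤ 9 * p := by
      calc ∑ i, A (Sum.inl i) j ^ 2 ≤ ∑ i : Fin p, (9 : ℝ) :=
            Finset.sum_le_sum (fun i _ => ha i j)
        _ = 9 * p := by simp; ring
    have h2 : ∑ l, A (Sum.inr l) j ^ 2 = p := by
      simp only [A, ite_pow, Real.sq_sqrt hp0]
      simp
    linarith
  obtain ⟨t, ht⟩ := maurey A (10 * p) hA w hw1 k
  rw [Fintype.sum_sum_type] at ht
  have hin : ∑ l, (∑ j, (netvec t j - k * w j) * A (Sum.inr l) j) ^ 2 =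
      p * ∑ j, (netvec t j - k * w j) ^ 2 := by
    simp only [A, mul_ite, mul_zero, Finset.sum_ite_eq', Finset.mem_univ, if_true, mul_pow,
      Real.sq_sqrt hp0]
    rw [← Finset.sum_mul, mul_comm]
  rw [hin] at ht
  have ht' : ∑ i, (∑ j, (netvec t j - k * w j) * a i j) ^ 2 +
    p * ∑ j, (netvec t j - k * w j) ^ 2 ≤ k * (10 * p) := ht
  have hn := hnet t
  set z := netvec t
  have q1 : ∑ i, (∑ j, z j * a i j) ^ 2 ≤ 2 * ((k : ℝ) ^ 2 * ∑ i, (∑ j, w j * a i j) ^ 2) +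
      2 * ∑ i, (∑ j, (z j - k * w j) * a i j) ^ 2 := by
    rw [Finset.mul_sum, Finset.mul_sum, Finset.mul_sum, ← Finset.sum_add_distrib]
    apply Finset.sum_le_sum
    intro i _
    have : ∑ j, z j * a i j = k * (∑ j, w j * a i j) + ∑ j, (z j - k * w j) * a i j := by
      rw [Finset.mul_sum, ← Finset.sum_add_distrib]
      apply Finset.sum_congr rfl
      intro j _
      ring
    rw [this]
    nlinarith [sq_nonneg (k * (∑ j, w j * a i j) - ∑ j, (z j - k * w j) * a i j)]
  have q2 : (k : ℝ) ^ 2 * ∑ j, w j ^ 2 ≤ 2 * (∑ j, z j ^ 2) + 2 * ∑ j, (z j - k * w j) ^ 2 := by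
    rw [Finset.mul_sum, Finset.mul_sum, Finset.mul_sum, ← Finset.sum_add_distrib]
    apply Finset.sum_le_sum
    intro j _
    nlinarith [sq_nonneg (z j + (z j - k * w j))]
  have e1 : ∑ j, v j ^ 2 = R ^ 2 * ∑ j, w j ^ 2 := by
    rw [Finset.mul_sum]
    apply Finset.sum_congr rfl
    intro j _
    rw [hvw]
    ring
  have e2 : ∑ i, (∑ j, v j * a i j) ^ 2 = R ^ 2 * ∑ i, (∑ j, w j * a i j) ^ 2 := by
    rw [Finset.mul_sum]
    apply Finset.sum_congr rfl
    intro i _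
    rw [← mul_pow, Finset.mul_sum]
    congr 1
    apply Finset.sum_congr rfl
    intro j _
    rw [hvw]
    ring
  have hV : 1 ≤ 4 * s * ∑ j, w j ^ 2 := by
    rw [e1] at hv
    have hR2 : 0 < R ^ 2 := by positivity
    by_contra! hc
    have := mul_lt_mul_of_pos_left hc hR2
    linarith
  rw [e1, e2]
  set V := ∑ j, w j ^ 2
  set N := ∑ i, (∑ j, w j * a i j) ^ 2
  set D1 := ∑ i, (∑ j, (z j - k * w j) * a i j) ^ 2
  set D2 := ∑ j, (z j - k * w j) ^ 2
  set Z := ∑ j, z j ^ 2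
  have hD2 : 0 ≤ D2 := Finset.sum_nonneg (fun j _ => sq_nonneg _)
  have hD1 : 0 ≤ D1 := Finset.sum_nonneg (fun j _ => sq_nonneg _)
  have hkr : (k : ℝ) = 800 * s := by rw [hk]; push_cast; ring
  have hs' : (0 : ℝ) < s := by exact_mod_cast hs
  have hk0 : (0 : ℝ) < k := by rw [hkr]; positivity
  have hkey : (p : ℝ) * (k ^ 2 * V) / 16 ≤ k ^ 2 * N := by
    have m1 : (p : ℝ) * (k ^ 2 * V) ≤ p * (2 * Z + 2 * D2) := by gcongr
    have m2 : (k : ℝ) * (10 * p) * 1 ≤ k * (10 * p) * (4 * s * V) := by gcongr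
    have m3 : (k : ℝ) * (10 * p) * (4 * s * V) = p * (k ^ 2 * V) / 20 := by
      rw [hkr]
      ring
    have m4 : 0 ≤ (p : ℝ) * D2 := by positivity
    linarith
  have : (p : ℝ) / 16 * V ≤ N := by
    have hk2 : (0 : ℝ) < k ^ 2 := by positivity
    by_contra! hc
    have := mul_lt_mul_of_pos_left hc hk2
    linarith
  nlinarith [mul_le_mul_of_nonneg_left this (sq_nonneg R)]

/-- The error of an `ℓ₁`-minimizer lies in a cone. -/
lemma cone_mem {n h : ℕ} (α' αs : Idx n → ℝ) (hsp : Sparse h (fun q : QIdx n => α' (Sum.inl q)))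
    (hmin : l1 (fun q : QIdx n => αs (Sum.inl q)) ≤ l1 (fun q : QIdx n => α' (Sum.inl q))) :
    (∑ j, |αs j - α' j|) ^ 2 ≤ 4 * ((h + n + 1 : ℕ) : ℝ) * ∑ j, (αs j - α' j) ^ 2 := by
  classical
  set S : Finset (QIdx n) := Finset.univ.filter (fun q => α' (Sum.inl q) ≠ 0) with hS
  have hcard : S.card ≤ h := by
    have : card' (fun q : QIdx n => α' (Sum.inl q)) = S.card := by
      unfold card'
      rw [Nat.card_eq_fintype_card, Fintype.card_subtype]
    rw [← this]
    exact hsp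
  set v : Idx n → ℝ := fun j => αs j - α' j with hv
  set T : Finset (Idx n) := S.disjSum Finset.univ with hT
  have hTc : T.card ≤ h + n + 1 := by
    rw [hT, Finset.card_disjSum]
    simp
    omega
  unfold l1 at hmin
  have h1 : ∑ q ∈ Sᶜ, |v (Sum.inl q)| ≤ ∑ q ∈ S, |v (Sum.inl q)| := by
    rw [← Finset.sum_add_sum_compl S, ← Finset.sum_add_sum_compl S
      (fun q => |α' (Sum.inl q)|)] at hmin
    have a1 : ∑ q ∈ Sᶜ, |α' (Sum.inl q)| = 0 := by
      apply Finset.sum_eq_zero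
      intro q hq
      simp [hS] at hq
      simp [hq]
    have a2 : ∑ q ∈ Sᶜ, |αs (Sum.inl q)| = ∑ q ∈ Sᶜ, |v (Sum.inl q)| := by
      apply Finset.sum_congr rfl
      intro q hq
      simp [hS] at hq
      simp [hv, hq]
    have a3 : ∑ q ∈ S, |α' (Sum.inl q)| ≤ ∑ q ∈ S, |αs (Sum.inl q)| +
        ∑ q ∈ S, |v (Sum.inl q)| := by
      rw [← Finset.sum_add_distrib]
      apply Finset.sum_le_sum
      intro q _
      simp only [hv]
      have := abs_sub_abs_le_abs_sub (α' (Sum.inl q)) (αs (Sum.inl q))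
      rw [abs_sub_comm] at this
      linarith
    linarith
  have h2 : ∑ j, |v j| ≤ 2 * ∑ j ∈ T, |v j| := by
    rw [Fintype.sum_sum_type, hT, Finset.sum_disjSum,
      ← Finset.sum_add_sum_compl S (fun q => |v (Sum.inl q)|)]
    have : 0 ≤ ∑ l : LIdx n, |v (Sum.inr l)| := Finset.sum_nonneg (fun _ _ => abs_nonneg _)
    linarith
  have h3 : (∑ j ∈ T, |v j|) ^ 2 ≤ T.card * ∑ j ∈ T, |v j| ^ 2 := sq_sum_le_card_mul_sum_sq
  have h4 : ∑ j ∈ T, |v j| ^ 2 ≤ ∑ j, v j ^ 2 := by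
    simp only [sq_abs]
    exact Finset.sum_le_univ_sum_of_nonneg (fun j => sq_nonneg _)
  have h5 : (T.card : ℝ) ≤ ((h + n + 1 : ℕ) : ℝ) := by exact_mod_cast hTc
  have h0 : 0 ≤ ∑ j, |v j| := Finset.sum_nonneg (fun _ _ => abs_nonneg _)
  have h6 : 0 ≤ ∑ j ∈ T, |v j| ^ 2 := Finset.sum_nonneg (fun _ _ => by positivity)
  calc (∑ j, |v j|) ^ 2 ≤ (2 * ∑ j ∈ T, |v j|) ^ 2 := by gcongr
    _ = 4 * (∑ j ∈ T, |v j|) ^ 2 := by ring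
    _ ≤ 4 * (T.card * ∑ j ∈ T, |v j| ^ 2) := by gcongr
    _ ≤ 4 * (((h + n + 1 : ℕ) : ℝ) * ∑ j, v j ^ 2) := by gcongr
    _ = _ := by ring

/-! ### Derivatives of the basis -/

lemma psi_sq_le {n : ℕ} {Δ : ℝ} (hΔ : 0 < Δ) (ι : Idx n) {x : Fin n → ℝ} (hx : x ∈ cube n Δ) :
    psi n Δ ι x ^ 2 ≤ 9 := by
  rcases ι with (i | p) | (i | u)
  · have := ph2_bd hΔ (hx i)
    change ph2 Δ (x i) ^ 2 ≤ 9
    linarith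
  · have h1 := ph1_bd hΔ (hx p.1.1)
    have h2 := ph1_bd hΔ (hx p.1.2)
    have h3 : Real.sqrt 3 * Real.sqrt 3 = 3 := Real.mul_self_sqrt (by norm_num)
    have e : psi n Δ (Sum.inl (Sum.inr p)) x = ph1 Δ (x p.1.1) * ph1 Δ (x p.1.2) := by
      simp only [psi, ph1]
      linear_combination (-(x p.1.1 * x p.1.2) / Δ ^ 2) * h3
    rw [e, mul_pow]
    calc ph1 Δ (x p.1.1) ^ 2 * ph1 Δ (x p.1.2) ^ 2 ≤ 3 * 3 := by gcongr
      _ = 9 := by norm_num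
  · have := ph1_bd hΔ (hx i)
    change ph1 Δ (x i) ^ 2 ≤ 9
    linarith
  · norm_num [psi]

/-- Kronecker delta. -/
def kdel {n : ℕ} (i a : Fin n) : ℝ := (Pi.single i (1 : ℝ) : Fin n → ℝ) a

lemma kdel_abs {n : ℕ} (i a : Fin n) : |kdel i a| ≤ 1 := by
  unfold kdel
  rw [Pi.single_apply]
  split_ifs <;> norm_num

/-- First partial derivatives of the basis. -/
noncomputable def dpsi (n : ℕ) (Δ : ℝ) : Idx n → Fin n → (Fin n → ℝ) → ℝ
  | Sum.inl (Sum.inl a), i => fun x => 3 * Real.sqrt 5 / Δ ^ 2 * kdel i a * x a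
  | Sum.inl (Sum.inr p), i => fun x => 3 / Δ ^ 2 * kdel i p.1.2 * x p.1.1 +
      3 / Δ ^ 2 * kdel i p.1.1 * x p.1.2
  | Sum.inr (Sum.inl a), i => fun _ => Real.sqrt 3 / Δ * kdel i a
  | Sum.inr (Sum.inr _), _ => fun _ => 0

/-- Second partial derivatives of the basis. -/
noncomputable def d2psi (n : ℕ) (Δ : ℝ) : Idx n → Fin n → Fin n → ℝ
  | Sum.inl (Sum.inl a), j, i => 3 * Real.sqrt 5 / Δ ^ 2 * kdel j a * kdel i a
  | Sum.inl (Sum.inr p), j, i => 3 / Δ ^ 2 * kdel j p.1.2 * kdel i p.1.1 +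
      3 / Δ ^ 2 * kdel j p.1.1 * kdel i p.1.2
  | Sum.inr (Sum.inl _), _, _ => 0
  | Sum.inr (Sum.inr _), _, _ => 0

lemma hasF_coord {n : ℕ} (x₀ x : Fin n → ℝ) (a : Fin n) :
    HasFDerivAt (fun y : Fin n → ℝ => (y - x₀) a)
      (ContinuousLinearMap.proj (R := ℝ) (φ := fun _ : Fin n => ℝ) a) x := by
  have := (ContinuousLinearMap.proj (R := ℝ) (φ := fun _ : Fin n => ℝ) a).hasFDerivAt (x := x)
  exact this.sub_const (x₀ a)

lemma hasF_psi {n : ℕ} {Δ : ℝ} (x₀ x : Fin n → ℝ) (ι : Idx n) :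
    ∃ L : (Fin n → ℝ) →L[ℝ] ℝ, HasFDerivAt (fun y => psi n Δ ι (y - x₀)) L x ∧
      ∀ i, L (Pi.single i 1) = dpsi n Δ ι i (x - x₀) := by
  rcases ι with (a | p) | (a | u)
  · refine ⟨_, (((hasF_coord x₀ x a).pow 2).const_mul (3 * Real.sqrt 5 / (2 * Δ ^ 2))).sub_const
      (Real.sqrt 5 / 2), ?_⟩
    intro i
    simp [dpsi, kdel]
    ring
  · refine ⟨_, ((hasF_coord x₀ x p.1.1).mul (hasF_coord x₀ x p.1.2)).const_mul (3 / Δ ^ 2), ?_⟩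
    intro i
    simp [dpsi, kdel]
    ring
  · refine ⟨_, (hasF_coord x₀ x a).const_mul (Real.sqrt 3 / Δ), ?_⟩
    intro i
    simp [dpsi, kdel]
  · refine ⟨0, hasFDerivAt_const _ _, ?_⟩
    intro i
    simp [dpsi]

lemma hasF_dpsi {n : ℕ} {Δ : ℝ} (x₀ x : Fin n → ℝ) (ι : Idx n) (j : Fin n) :
    ∃ L : (Fin n → ℝ) →L[ℝ] ℝ, HasFDerivAt (fun y => dpsi n Δ ι j (y - x₀)) L x ∧
      ∀ i, L (Pi.single i 1) = d2psi n Δ ι j i := by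
  rcases ι with (a | p) | (a | u)
  · refine ⟨_, (hasF_coord x₀ x a).const_mul (3 * Real.sqrt 5 / Δ ^ 2 * kdel j a), ?_⟩
    intro i
    simp [d2psi, kdel]
  · refine ⟨_, ((hasF_coord x₀ x p.1.1).const_mul (3 / Δ ^ 2 * kdel j p.1.2)).add
      ((hasF_coord x₀ x p.1.2).const_mul (3 / Δ ^ 2 * kdel j p.1.1)), ?_⟩
    intro i
    simp [d2psi, kdel]
  · refine ⟨0, hasFDerivAt_const _ _, ?_⟩
    intro i
    simp [d2psi]
  · refine ⟨0, hasFDerivAt_const _ _, ?_⟩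
    intro i
    simp [d2psi]

lemma grad_mod {n : ℕ} {Δ : ℝ} (x₀ x : Fin n → ℝ) (α : Idx n → ℝ) (i : Fin n) :
    fderiv ℝ (fun y => ∑ ι, α ι * psi n Δ ι (y - x₀)) x (Pi.single i 1) =
      ∑ ι, α ι * dpsi n Δ ι i (x - x₀) := by
  choose L hL hL2 using fun ι => hasF_psi (Δ := Δ) x₀ x ι
  have := HasFDerivAt.fun_sum (u := Finset.univ) (fun ι _ => (hL ι).const_mul (α ι))
  rw [this.fderiv]
  simp [hL2]

lemma hess_mod {n : ℕ} {Δ : ℝ} (x₀ x : Fin n → ℝ) (α : Idx n → ℝ) (i j : Fin n) :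
    hess (fun y => ∑ ι, α ι * psi n Δ ι (y - x₀)) x i j =
      ∑ ι, α ι * d2psi n Δ ι j i := by
  unfold hess
  simp only [grad_mod]
  choose L hL hL2 using fun ι => hasF_dpsi (Δ := Δ) x₀ x ι j
  have := HasFDerivAt.fun_sum (u := Finset.univ) (fun ι _ => (hL ι).const_mul (α ι))
  rw [this.fderiv]
  simp [hL2]

lemma sqrt5_bd : 3 * Real.sqrt 5 ≤ 7 := by
  have : Real.sqrt 5 ≤ 7 / 3 := by
    rw [Real.sqrt_le_left (by norm_num)]
    norm_num
  linarith

lemma sqrt3_bd : Real.sqrt 3 ≤ 7 := by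
  rw [Real.sqrt_le_left (by norm_num)]
  norm_num

lemma dpsi_bd {n : ℕ} {Δ : ℝ} (hΔ : 0 < Δ) (ι : Idx n) (i : Fin n) {x : Fin n → ℝ}
    (hx : x ∈ cube n Δ) : |dpsi n Δ ι i x| ≤ 7 / Δ := by
  rcases ι with (a | p) | (a | u)
  · simp only [dpsi, abs_mul]
    rw [abs_of_nonneg (by positivity : (0 : ℝ) ≤ 3 * Real.sqrt 5 / Δ ^ 2)]
    calc 3 * Real.sqrt 5 / Δ ^ 2 * |kdel i a| * |x a| ≤ 7 / Δ ^ 2 * 1 * Δ := by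
          gcongr
          · exact sqrt5_bd
          · exact kdel_abs i a
          · exact hx a
      _ = 7 / Δ := by field_simp
  · simp only [dpsi]
    refine (abs_add_le _ _).trans ?_
    simp only [abs_mul]
    rw [abs_of_nonneg (by positivity : (0 : ℝ) ≤ 3 / Δ ^ 2)]
    calc 3 / Δ ^ 2 * |kdel i p.1.2| * |x p.1.1| + 3 / Δ ^ 2 * |kdel i p.1.1| * |x p.1.2|
        ≤ 3 / Δ ^ 2 * 1 * Δ + 3 / Δ ^ 2 * 1 * Δ := by
          gcongr
          · exact kdel_abs _ _
          · exact hx _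
          · exact kdel_abs _ _
          · exact hx _
      _ = 6 / Δ := by field_simp; norm_num
      _ ≤ 7 / Δ := by gcongr; norm_num
  · simp only [dpsi, abs_mul]
    rw [abs_of_nonneg (by positivity : (0 : ℝ) ≤ Real.sqrt 3 / Δ)]
    calc Real.sqrt 3 / Δ * |kdel i a| ≤ 7 / Δ * 1 := by
          gcongr
          · exact sqrt3_bd
          · exact kdel_abs i a
      _ = 7 / Δ := by ring
  · simp only [dpsi, abs_zero]
    positivity

lemma d2psi_bd {n : ℕ} {Δ : ℝ} (hΔ : 0 < Δ) (ι : Idx n) (j i : Fin n) :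
    |d2psi n Δ ι j i| ≤ 7 / Δ ^ 2 := by
  rcases ι with (a | p) | (a | u)
  · simp only [d2psi, abs_mul]
    rw [abs_of_nonneg (by positivity : (0 : ℝ) ≤ 3 * Real.sqrt 5 / Δ ^ 2)]
    calc 3 * Real.sqrt 5 / Δ ^ 2 * |kdel j a| * |kdel i a| ≤ 7 / Δ ^ 2 * 1 * 1 := by
          gcongr
          · exact sqrt5_bd
          · exact kdel_abs _ a
          · exact kdel_abs _ a
      _ = 7 / Δ ^ 2 := by ring
  · simp only [d2psi]
    refine (abs_add_le _ _).trans ?_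
    simp only [abs_mul]
    rw [abs_of_nonneg (by positivity : (0 : ℝ) ≤ 3 / Δ ^ 2)]
    calc 3 / Δ ^ 2 * |kdel j p.1.2| * |kdel i p.1.1| + 3 / Δ ^ 2 * |kdel j p.1.1| * |kdel i p.1.2|
        ≤ 3 / Δ ^ 2 * 1 * 1 + 3 / Δ ^ 2 * 1 * 1 := by
          gcongr <;> exact kdel_abs _ _
      _ = 6 / Δ ^ 2 := by ring
      _ ≤ 7 / Δ ^ 2 := by gcongr; norm_num
  · simp only [d2psi, abs_zero]
    positivity
  · simp only [d2psi, abs_zero]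
    positivity

/-! ### Norm facts -/

lemma l2_eq {ι : Type*} [Fintype ι] (v : ι → ℝ) : l2 v = ‖WithLp.toLp 2 v‖ := by
  rw [EuclideanSpace.norm_eq]
  simp [l2]

lemma l2_add_le {ι : Type*} [Fintype ι] (v w : ι → ℝ) : l2 (v + w) ≤ l2 v + l2 w := by
  rw [l2_eq, l2_eq, l2_eq]
  exact norm_add_le (WithLp.toLp 2 v) (WithLp.toLp 2 w)

lemma l2_sub_le {ι : Type*} [Fintype ι] (v w : ι → ℝ) : l2 (v - w) ≤ l2 v + l2 w := by
  rw [l2_eq, l2_eq, l2_eq]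
  exact norm_sub_le (WithLp.toLp 2 v) (WithLp.toLp 2 w)

lemma l2_sq {ι : Type*} [Fintype ι] (v : ι → ℝ) : l2 v ^ 2 = ∑ i, v i ^ 2 :=
  Real.sq_sqrt (Finset.sum_nonneg (fun _ _ => sq_nonneg _))

lemma l2_nonneg {ι : Type*} [Fintype ι] (v : ι → ℝ) : 0 ≤ l2 v := Real.sqrt_nonneg _

lemma abs_le_l2 {ι : Type*} [Fintype ι] (v : ι → ℝ) (i : ι) : |v i| ≤ l2 v := by
  apply Real.abs_le_sqrt
  exact Finset.single_le_sum (f := fun i => v i ^ 2) (fun _ _ => sq_nonneg _) (Finset.mem_univ i)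

lemma l2_le_card {ι : Type*} [Fintype ι] (v : ι → ℝ) {C : ℝ} (hv : ∀ i, |v i| ≤ C) :
    l2 v ≤ Fintype.card ι * C := by
  have h0 : l2 v ≤ ∑ i, |v i| := by
    unfold l2
    rw [Real.sqrt_le_left (Finset.sum_nonneg (fun _ _ => abs_nonneg _))]
    calc ∑ i, v i ^ 2 = ∑ i, |v i| ^ 2 := by simp only [sq_abs]
      _ ≤ (∑ i, |v i|) ^ 2 := Finset.sum_sq_le_sq_sum_of_nonneg (fun _ _ => abs_nonneg _)
  refine h0.trans ?_
  calc ∑ i, |v i| ≤ ∑ i : ι, C := Finset.sum_le_sum (fun i _ => hv i)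
    _ = Fintype.card ι * C := by simp

lemma mulVec_l2_le {n : ℕ} (G : Matrix (Fin n) (Fin n) ℝ) {C : ℝ} (hG : ∀ i j, |G i j| ≤ C)
    {v : Fin n → ℝ} (hv : l2 v ≤ 1) : l2 (G.mulVec v) ≤ n * (n * C) := by
  have := l2_le_card (G.mulVec v) (C := n * C) ?_
  · simpa using this
  · intro i
    calc |G.mulVec v i| = |∑ j, G i j * v j| := rfl
      _ ≤ ∑ j, |G i j * v j| := Finset.abs_sum_le_sum_abs _ _
      _ ≤ ∑ j : Fin n, C := by
          apply Finset.sum_le_sum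
          intro j _
          rw [abs_mul]
          have h1 := (abs_le_l2 v j).trans hv
          calc |G i j| * |v j| ≤ |G i j| * 1 := by gcongr
            _ ≤ C := by rw [mul_one]; exact hG i j
      _ = n * C := by simp

lemma specNorm_add_le {n : ℕ} (H G : Matrix (Fin n) (Fin n) ℝ) {C : ℝ} (hG : ∀ i j, |G i j| ≤ C) :
    specNorm (H + G) ≤ specNorm H + n * (n * C) := by
  unfold specNorm
  apply csSup_le
  · exact ⟨_, ⟨0, by simp [l2], rfl⟩⟩
  · rintro _ ⟨v, hv, rfl⟩
    simp only
    rw [Matrix.add_mulVec]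
    refine (l2_add_le _ _).trans ?_
    apply add_le_add _ (mulVec_l2_le G hG hv)
    refine le_csSup ?_ (Set.mem_image_of_mem (fun v => l2 (H.mulVec v)) hv)
    refine ⟨n * (n * ∑ i, ∑ j, |H i j|), ?_⟩
    rintro _ ⟨w, hw, rfl⟩
    apply mulVec_l2_le H _ hw
    intro i j
    calc |H i j| ≤ ∑ j, |H i j| :=
          Finset.single_le_sum (f := fun j => |H i j|) (fun _ _ => abs_nonneg _) (Finset.mem_univ j)
      _ ≤ _ := Finset.single_le_sum (f := fun i => ∑ j, |H i j|)
          (fun _ _ => Finset.sum_nonneg (fun _ _ => abs_nonneg _)) (Finset.mem_univ i)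

lemma sum_diff_bd {I : Type*} [Fintype I] (α β w : I → ℝ) {E C : ℝ} (hE : ∀ i, |β i - α i| ≤ E)
    (hC : ∀ i, |w i| ≤ C) :
    |∑ i, α i * w i - ∑ i, β i * w i| ≤ Fintype.card I * (E * C) := by
  rw [← Finset.sum_sub_distrib]
  calc |∑ i, (α i * w i - β i * w i)| ≤ ∑ i, |α i * w i - β i * w i| :=
        Finset.abs_sum_le_sum_abs _ _
    _ ≤ ∑ i : I, E * C := by
        apply Finset.sum_le_sum
        intro i _
        rw [← sub_mul, abs_mul, abs_sub_comm]
        exact mul_le_mul (hE i) (hC i) (abs_nonneg _) ((abs_nonneg _).trans (hE i))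
    _ = _ := by simp

lemma fq_transfer {n : ℕ} {Δ : ℝ} (hΔ : 0 < Δ) (f : (Fin n → ℝ) → ℝ) (x₀ : Fin n → ℝ)
    (α' αs : Idx n → ℝ) {κ κeg κeh : ℝ} (hκ : 0 < κ)
    (hfq : FullyQuadraticOn f (fun x => ∑ ι, α' ι * psi n Δ ι (x - x₀)) x₀ Δ κ κeg κeh)
    (hv : l2 (fun j => αs j - α' j) ≤ 8 * κ * Δ ^ 3) :
    FullyQuadraticOn f (fun x => ∑ ι, αs ι * psi n Δ ι (x - x₀)) x₀ Δ
      (κ + Fintype.card (Idx n) * (24 * κ)) (κeg + n * (Fintype.card (Idx n) * (56 * κ)))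
      (κeh + n * (n * (Fintype.card (Idx n) * (56 * κ)))) := by
  have hE : ∀ j, |αs j - α' j| ≤ 8 * κ * Δ ^ 3 := fun j =>
    (abs_le_l2 (fun j => αs j - α' j) j).trans hv
  set q : ℝ := ((Fintype.card (Idx n) : ℕ) : ℝ) with hq
  intro x hx
  obtain ⟨h1, h2, h3⟩ := hfq x hx
  refine ⟨?_, ?_, ?_⟩
  · have hb := sum_diff_bd α' αs (fun ι => psi n Δ ι (x - x₀)) hE (C := 3)
      (fun ι => abs_le_of_sq_le_sq (by norm_num; exact psi_sq_le hΔ ι hx) (by norm_num))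
    have := abs_sub_le (f x) (∑ ι, α' ι * psi n Δ ι (x - x₀)) (∑ ι, αs ι * psi n Δ ι (x - x₀))
    simp only at h1 hb ⊢
    rw [← hq] at hb
    linarith
  · have e : grad f x - grad (fun x => ∑ ι, αs ι * psi n Δ ι (x - x₀)) x =
      (grad f x - grad (fun x => ∑ ι, α' ι * psi n Δ ι (x - x₀)) x) +
        (grad (fun x => ∑ ι, α' ι * psi n Δ ι (x - x₀)) x -
          grad (fun x => ∑ ι, αs ι * psi n Δ ι (x - x₀)) x) := by abel
    rw [e]
    refine (l2_add_le _ _).trans ?_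
    have hb := l2_le_card (grad (fun x => ∑ ι, α' ι * psi n Δ ι (x - x₀)) x -
          grad (fun x => ∑ ι, αs ι * psi n Δ ι (x - x₀)) x) (C := q * (56 * κ) * Δ ^ 2) ?_
    · rw [Fintype.card_fin] at hb
      linarith
    · intro i
      rw [Pi.sub_apply]
      unfold grad
      rw [grad_mod, grad_mod]
      refine (sum_diff_bd α' αs (fun ι => dpsi n Δ ι i (x - x₀)) hE
        (fun ι => dpsi_bd hΔ ι i hx)).trans (le_of_eq ?_)
      rw [← hq]
      field_simp
      ring
  · have e : hess f x - hess (fun x => ∑ ι, αs ι * psi n Δ ι (x - x₀)) x =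
      (hess f x - hess (fun x => ∑ ι, α' ι * psi n Δ ι (x - x₀)) x) +
        (hess (fun x => ∑ ι, α' ι * psi n Δ ι (x - x₀)) x -
          hess (fun x => ∑ ι, αs ι * psi n Δ ι (x - x₀)) x) := by abel
    rw [e]
    refine (specNorm_add_le _ _ (C := q * (56 * κ) * Δ) ?_).trans ?_
    · intro i j
      rw [Matrix.sub_apply, hess_mod, hess_mod]
      refine (sum_diff_bd α' αs (fun ι => d2psi n Δ ι j i) hE
        (fun ι => d2psi_bd hΔ ι j i)).trans (le_of_eq ?_)
      rw [← hq]
      field_simp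
      ring
    · linarith

/-! ### Probability of the good event -/

lemma good_event {n : ℕ} {Δ : ℝ} (hΔ : 0 < Δ) (p k : ℕ) :
    1 - (2 * (Fintype.card (Idx n) : ℝ)) ^ k * Real.exp (-(p / (16 * KK))) ≤
    (Measure.pi (fun _ : Fin p => mu n Δ)).real {Y | (∀ i, Y i ∈ cube n Δ) ∧
      ∀ t : Fin k → Idx n × Bool, (p : ℝ) * (∑ j, netvec t j ^ 2) / 2 ≤
        ∑ i, ev n Δ (netvec t) (Y i) ^ 2} := by
  have := mu_prob n hΔ
  set P := Measure.pi (fun _ : Fin p => mu n Δ) with hP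
  set G : Set (Fin p → Fin n → ℝ) := {Y | (∀ i, Y i ∈ cube n Δ) ∧
      ∀ t : Fin k → Idx n × Bool, (p : ℝ) * (∑ j, netvec t j ^ 2) / 2 ≤
        ∑ i, ev n Δ (netvec t) (Y i) ^ 2} with hG
  have hcube : ∀ᵐ Y ∂P, ∀ i, Y i ∈ cube n Δ := by
    rw [ae_all_iff]
    intro i
    exact (Measure.quasiMeasurePreserving_eval (fun _ : Fin p => mu n Δ) i).ae (mu_ae_cube n hΔ)
  have hc0 : P.real {Y | ¬ ∀ i, Y i ∈ cube n Δ} = 0 := by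
    rw [measureReal_def, ae_iff.mp hcube]
    simp
  have hbad : ∀ t : Fin k → Idx n × Bool,
      P.real {Y | ∑ i, ev n Δ (netvec t) (Y i) ^ 2 < (p : ℝ) * (∑ j, netvec t j ^ 2) / 2} ≤
        Real.exp (-(p / (16 * KK))) := by
    intro t
    obtain ⟨h1, h2⟩ := ev_moments hΔ (netvec t)
    have hc := ev_cont (Δ := Δ) (netvec t)
    have := lower_tail (mu n Δ) (fun x => ev n Δ (netvec t) x ^ 2) (hc.pow 2).measurable
      (fun x => sq_nonneg _) (cont_int hΔ (hc.pow 2)) (cont_int hΔ ((hc.pow 2).pow 2))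
      (K := KK) (by norm_num [KK]) h2 p
    rw [h1] at this
    exact this
  have hcov : (Set.univ : Set (Fin p → Fin n → ℝ)) ⊆ G ∪ ({Y | ¬ ∀ i, Y i ∈ cube n Δ} ∪
      ⋃ t : Fin k → Idx n × Bool,
        {Y | ∑ i, ev n Δ (netvec t) (Y i) ^ 2 < (p : ℝ) * (∑ j, netvec t j ^ 2) / 2}) := by
    intro Y _
    by_cases h1 : ∀ i, Y i ∈ cube n Δ
    · by_cases h2 : ∀ t : Fin k → Idx n × Bool, (p : ℝ) * (∑ j, netvec t j ^ 2) / 2 ≤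
        ∑ i, ev n Δ (netvec t) (Y i) ^ 2
      · exact Or.inl ⟨h1, h2⟩
      · push Not at h2
        obtain ⟨t, ht⟩ := h2
        exact Or.inr (Or.inr (Set.mem_iUnion.mpr ⟨t, ht⟩))
    · exact Or.inr (Or.inl h1)
  have hle := measureReal_mono (μ := P) hcov (measure_ne_top _ _)
  rw [probReal_univ] at hle
  have hU : P.real (⋃ t : Fin k → Idx n × Bool,
        {Y | ∑ i, ev n Δ (netvec t) (Y i) ^ 2 < (p : ℝ) * (∑ j, netvec t j ^ 2) / 2}) ≤
      (2 * (Fintype.card (Idx n) : ℝ)) ^ k * Real.exp (-(p / (16 * KK))) := by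
    refine (measureReal_iUnion_fintype_le _).trans ?_
    refine (Finset.sum_le_sum (fun t _ => hbad t)).trans (le_of_eq ?_)
    rw [Finset.sum_const, Finset.card_univ, Fintype.card_fun, Fintype.card_fin, Fintype.card_prod,
      Fintype.card_bool, nsmul_eq_mul]
    push_cast
    ring
  have a1 := measureReal_union_le (μ := P) G ({Y | ¬ ∀ i, Y i ∈ cube n Δ} ∪
      ⋃ t : Fin k → Idx n × Bool,
        {Y | ∑ i, ev n Δ (netvec t) (Y i) ^ 2 < (p : ℝ) * (∑ j, netvec t j ^ 2) / 2})
  have a2 := measureReal_union_le (μ := P) {Y | ¬ ∀ i, Y i ∈ cube n Δ}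
      (⋃ t : Fin k → Idx n × Bool,
        {Y | ∑ i, ev n Δ (netvec t) (Y i) ^ 2 < (p : ℝ) * (∑ j, netvec t j ^ 2) / 2})
  linarith

lemma card_idx_le (n : ℕ) : Fintype.card (Idx n) ≤ (n + 1) ^ 2 := by
  have h : Fintype.card (Pairs n) ≤ n * n := by
    calc Fintype.card (Pairs n) ≤ Fintype.card (Fin n × Fin n) := Fintype.card_subtype_le _
      _ = n * n := by simp
  rw [Fintype.card_sum, Fintype.card_sum, Fintype.card_sum]
  simp only [Fintype.card_fin, Fintype.card_unit]
  nlinarith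

lemma numeric_bound {n h p : ℕ} (hn : 2 ≤ n) (hh : 1 ≤ h)
    (hp : 9 * (16 * KK * 4000) * ((h : ℝ) + n + 1) * Real.log ((h : ℝ) + n + 1) ^ 2 *
            Real.log ((n + 1) * (n + 2) / 2 : ℕ) ≤ (p : ℝ) / Real.log p) :
    (2 * (Fintype.card (Idx n) : ℝ)) ^ (800 * (h + n + 1)) * Real.exp (-(p / (16 * KK))) ≤
      (n : ℝ) ^ (-(1 * Real.log p)) := by
  have hKK : 0 < KK := by norm_num [KK]
  set q : ℕ := (n + 1) * (n + 2) / 2 with hq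
  have hq2 : 2 * (n + 1) ≤ q := by
    rw [hq, Nat.le_div_iff_mul_le (by norm_num)]
    nlinarith
  have hnR : (2 : ℝ) ≤ n := by exact_mod_cast hn
  have hhR : (1 : ℝ) ≤ h := by exact_mod_cast hh
  have hqR : 2 * ((n : ℝ) + 1) ≤ q := by exact_mod_cast hq2
  set s : ℝ := (h : ℝ) + n + 1 with hs
  have hs4 : 4 ≤ s := by linarith
  have hlogs : 1 ≤ Real.log s := by
    rw [Real.le_log_iff_exp_le (by linarith)]
    have := Real.exp_one_lt_d9
    linarith
  have hlogn : 0 < Real.log n := Real.log_pos (by linarith)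
  have hlognq : Real.log n ≤ Real.log q := Real.log_le_log (by linarith) (by linarith)
  have hlogq : 0 < Real.log q := by linarith
  have hLpos : 0 < 9 * (16 * KK * 4000) * s * Real.log s ^ 2 * Real.log q := by positivity
  have hp2 : 2 ≤ p := by
    by_contra! hc
    interval_cases p
    · simp at hp
      linarith
    · simp at hp
      linarith
  have hpR : (2 : ℝ) ≤ p := by exact_mod_cast hp2
  have hlogp : 1 / 2 ≤ Real.log p := by
    have h1 : Real.log 2 ≤ Real.log p := Real.log_le_log (by norm_num) hpR
    have := Real.log_two_gt_d9
    linarith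
  have hlogp0 : 0 < Real.log p := by linarith
  rw [le_div_iff₀ hlogp0] at hp
  set X : ℝ := s * Real.log q * Real.log p with hX
  have hX0 : 0 < X := by positivity
  have hpX : 9 * (16 * KK * 4000) * X ≤ p := by
    refine le_trans ?_ hp
    have h1 : (1 : ℝ) ≤ Real.log s ^ 2 := one_le_pow₀ hlogs
    have e : 9 * (16 * KK * 4000) * s * Real.log s ^ 2 * Real.log q * Real.log p =
      (9 * (16 * KK * 4000) * X) * Real.log s ^ 2 := by rw [hX]; ring
    rw [e]
    exact le_mul_of_one_le_right (by positivity) h1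
  have hcard : 2 * (Fintype.card (Idx n) : ℝ) ≤ Real.exp (2 * Real.log q) := by
    have h1 : (Fintype.card (Idx n) : ℝ) ≤ ((n : ℝ) + 1) ^ 2 := by exact_mod_cast card_idx_le n
    have h2 : Real.exp (2 * Real.log q) = (q : ℝ) ^ 2 := by
      rw [two_mul, Real.exp_add, Real.exp_log (by linarith)]
      ring
    rw [h2]
    have h3 : (2 * ((n : ℝ) + 1)) ^ 2 ≤ (q : ℝ) ^ 2 := by gcongr
    nlinarith
  have hpow : (2 * (Fintype.card (Idx n) : ℝ)) ^ (800 * (h + n + 1)) ≤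
      Real.exp (800 * s * (2 * Real.log q)) := by
    calc (2 * (Fintype.card (Idx n) : ℝ)) ^ (800 * (h + n + 1)) ≤
          Real.exp (2 * Real.log q) ^ (800 * (h + n + 1)) := by gcongr
      _ = _ := by
          rw [← Real.exp_nat_mul]
          congr 1
          rw [hs]
          push_cast
          ring
  have hrhs : (n : ℝ) ^ (-(1 * Real.log p)) = Real.exp (-(Real.log n * Real.log p)) := by
    rw [Real.rpow_def_of_pos (by linarith)]
    congr 1
    ring
  rw [hrhs]
  calc _ ≤ Real.exp (800 * s * (2 * Real.log q)) * Real.exp (-(p / (16 * KK))) := by gcongr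
    _ = Real.exp (800 * s * (2 * Real.log q) + -(p / (16 * KK))) := by rw [Real.exp_add]
    _ ≤ _ := by
      apply Real.exp_le_exp.mpr
      have m1 : s * Real.log q ≤ 2 * X := by
        have : s * Real.log q * (1 / 2) ≤ X := by
          rw [hX]
          gcongr
        linarith
      have m2 : Real.log n * Real.log p ≤ X := by
        have a : 1 * Real.log n ≤ s * Real.log q := by
          apply mul_le_mul (by linarith) hlognq hlogn.le (by linarith)
        rw [hX]
        rw [one_mul] at a
        gcongr
      have m3 : 36000 * X ≤ p / (16 * KK) := by
        rw [le_div_iff₀ (by positivity)]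
        linarith
      linarith

/-- Deterministic recovery on the good event. -/
lemma recovery {n h p : ℕ} {Δ : ℝ} (hΔ : 0 < Δ) (x₀ : Fin n → ℝ) (f : (Fin n → ℝ) → ℝ)
    {κ κeg κeh : ℝ} (hκ : 0 < κ) (hp : 0 < p) (α' αs : Idx n → ℝ)
    (hsp : Sparse h (fun q : QIdx n => α' (Sum.inl q)))
    (hfq : FullyQuadraticOn f (fun x => ∑ ι, α' ι * psi n Δ ι (x - x₀)) x₀ Δ κ κeg κeh)
    (Y : Fin p → Fin n → ℝ) (hY : ∀ i, Y i ∈ cube n Δ)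
    (hnet : ∀ t : Fin (800 * (h + n + 1)) → Idx n × Bool,
      (p : ℝ) * (∑ j, netvec t j ^ 2) / 2 ≤ ∑ i, ev n Δ (netvec t) (Y i) ^ 2)
    (hfeas : l2 ((Matrix.of fun (i : Fin p) (j : Idx n) => psi n Δ j (Y i)).mulVec αs -
                      fun i : Fin p => f (Y i + x₀)) ≤ Real.sqrt p * κ * Δ ^ 3)
    (hmin : ∀ β : Idx n → ℝ,
                    l2 ((Matrix.of fun (i : Fin p) (j : Idx n) => psi n Δ j (Y i)).mulVec β -
                        fun i : Fin p => f (Y i + x₀)) ≤ Real.sqrt p * κ * Δ ^ 3 →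
                      l1 (fun q : QIdx n => αs (Sum.inl q)) ≤
                        l1 (fun q : QIdx n => β (Sum.inl q))) :
    l2 (fun j => αs j - α' j) ≤ 8 * κ * Δ ^ 3 := by
  have hpR : (0 : ℝ) < p := by exact_mod_cast hp
  have hf' : l2 ((Matrix.of fun (i : Fin p) (j : Idx n) => psi n Δ j (Y i)).mulVec α' -
                      fun i : Fin p => f (Y i + x₀)) ≤ Real.sqrt p * κ * Δ ^ 3 := by
    unfold l2
    rw [Real.sqrt_le_left (by positivity)]
    calc _ ≤ ∑ i : Fin p, (κ * Δ ^ 3) ^ 2 := by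
          apply Finset.sum_le_sum
          intro i _
          have h1 := (hfq (Y i + x₀) (by simpa using hY i)).1
          simp only [add_sub_cancel_right] at h1
          have e : ((Matrix.of fun (i : Fin p) (j : Idx n) => psi n Δ j (Y i)).mulVec α' -
                      fun i : Fin p => f (Y i + x₀)) i =
              -(f (Y i + x₀) - ∑ ι, α' ι * psi n Δ ι (Y i)) := by
            simp only [Pi.sub_apply, Matrix.mulVec, dotProduct, Matrix.of_apply, neg_sub]
            congr 1
            apply Finset.sum_congr rfl
            intro j _
            ring
          rw [e, neg_sq, ← sq_abs]
          gcongr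
      _ = (Real.sqrt p * κ * Δ ^ 3) ^ 2 := by
          rw [mul_assoc, mul_pow (Real.sqrt p), Real.sq_sqrt hpR.le]
          simp
  have hcone := cone_mem α' αs hsp (hmin α' hf')
  have hcb := cone_bound (s := h + n + 1) rfl (by omega) (fun i j => psi n Δ j (Y i))
    (fun i j => psi_sq_le hΔ j (hY i)) hnet (fun j => αs j - α' j) hcone
  have htri := l2_sub_le ((Matrix.of fun (i : Fin p) (j : Idx n) => psi n Δ j (Y i)).mulVec αs -
                      fun i : Fin p => f (Y i + x₀))
        ((Matrix.of fun (i : Fin p) (j : Idx n) => psi n Δ j (Y i)).mulVec α' -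
                      fun i : Fin p => f (Y i + x₀))
  set D := ((Matrix.of fun (i : Fin p) (j : Idx n) => psi n Δ j (Y i)).mulVec αs -
                      fun i : Fin p => f (Y i + x₀)) -
        ((Matrix.of fun (i : Fin p) (j : Idx n) => psi n Δ j (Y i)).mulVec α' -
                      fun i : Fin p => f (Y i + x₀)) with hD
  have hD2 : ∑ i, (∑ j, (αs j - α' j) * psi n Δ j (Y i)) ^ 2 = l2 D ^ 2 := by
    rw [l2_sq]
    apply Finset.sum_congr rfl
    intro i _
    congr 1
    simp only [hD, Pi.sub_apply, Matrix.mulVec, dotProduct, Matrix.of_apply, sub_sub_sub_cancel_right]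
    rw [← Finset.sum_sub_distrib]
    apply Finset.sum_congr rfl
    intro j _
    ring
  have hDle : l2 D ≤ 2 * (Real.sqrt p * κ * Δ ^ 3) := by linarith
  have hDsq : l2 D ^ 2 ≤ (2 * (Real.sqrt p * κ * Δ ^ 3)) ^ 2 :=
    pow_le_pow_left₀ (l2_nonneg _) hDle 2
  have e1 : (2 * (Real.sqrt p * κ * Δ ^ 3)) ^ 2 = (p : ℝ) / 16 * (8 * κ * Δ ^ 3) ^ 2 := by
    have := Real.sq_sqrt hpR.le
    linear_combination (4 * κ ^ 2 * Δ ^ 6) * this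
  have hfin : (p : ℝ) / 16 * l2 (fun j => αs j - α' j) ^ 2 ≤ p / 16 * (8 * κ * Δ ^ 3) ^ 2 := by
    rw [l2_sq]
    linarith
  have := le_of_mul_le_mul_left hfin (by positivity)
  exact (le_abs_self _).trans (abs_le_of_sq_le_sq this (by positivity))

/-- (Main theorem: recovery of a fully quadratic model of a function with
(approximately) sparse Hessian from `ℓ₁`-minimization on random samples.) There are universal
constants `c, γ > 0` such that for all `n ≥ 2`, `h`, and `κ'_ef, κ'_eg, κ'_eh > 0`, there are
`κ_ef, κ_eg, κ_eh > 0` (independent of `x₀` and `Δ`) with the following property. Let `f` be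
twice continuously differentiable with Lipschitz continuous Hessian on an open set containing
`B_∞(x₀;Δ)`, and suppose some quadratic `m = Σ_ι α_ι ψ_ι(· − x₀)` with `h`-sparse quadratic part
is fully quadratic for `f` on `B_∞(x₀;Δ)` with constants `κ'_ef, κ'_eg, κ'_eh`. If
`p / log p ≥ 9c(h+n+1)(log(h+n+1))² log q` with `q = (n+1)(n+2)/2`, then with probability at
least `1 − n^{−γ log p}` over `Y ∼ μ^{⊗p}` (`μ` uniform on `B_∞(0;Δ)`), every minimizer `α*` of
`‖α_Q‖₁` over `{α : ‖M(ψ,Y)α − f(Y + x₀)‖₂ ≤ √p·κ'_ef·Δ³}` yields a quadratic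
`m*(x) = Σ_ι α*_ι ψ_ι(x − x₀)` that is fully quadratic for `f` on `B_∞(x₀;Δ)` with constants
`κ_ef, κ_eg, κ_eh`. -/
theorem fully_quadratic_recovery_from_random_samples :
    ∃ c > (0 : ℝ), ∃ γ > (0 : ℝ),
      ∀ (n : ℕ), 2 ≤ n →
      ∀ (h : ℕ), 1 ≤ h → h ≤ n * (n + 1) / 2 →
      ∀ (κ'ef κ'eg κ'eh : ℝ), 0 < κ'ef → 0 < κ'eg → 0 < κ'eh →
      ∃ κef > (0 : ℝ), ∃ κeg > (0 : ℝ), ∃ κeh > (0 : ℝ),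
        ∀ (Δ : ℝ), 0 < Δ → ∀ (x₀ : Fin n → ℝ) (f : (Fin n → ℝ) → ℝ),
        (∃ U : Set (Fin n → ℝ), IsOpen U ∧ {x | x - x₀ ∈ cube n Δ} ⊆ U ∧
          ContDiffOn ℝ 2 f U ∧
          ∃ L : NNReal, LipschitzOnWith L (fun x => fderiv ℝ (fderiv ℝ f) x) U) →
        (∃ α' : Idx n → ℝ, Sparse h (fun q : QIdx n => α' (Sum.inl q)) ∧
          FullyQuadraticOn f (fun x => ∑ ι, α' ι * psi n Δ ι (x - x₀)) x₀ Δ κ'ef κ'eg κ'eh) →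
        ∀ (p : ℕ),
        9 * c * ((h : ℝ) + n + 1) * Real.log ((h : ℝ) + n + 1) ^ 2 *
            Real.log ((n + 1) * (n + 2) / 2 : ℕ) ≤ (p : ℝ) / Real.log p →
        ENNReal.ofReal (1 - (n : ℝ) ^ (-(γ * Real.log p))) ≤
          Measure.pi (fun _ : Fin p => mu n Δ)
            {Y : Fin p → (Fin n → ℝ) |
              ∀ αstar : Idx n → ℝ,
                (l2 ((Matrix.of fun (i : Fin p) (j : Idx n) => psi n Δ j (Y i)).mulVec αstar -
                      fun i : Fin p => f (Y i + x₀)) ≤ Real.sqrt p * κ'ef * Δ ^ 3 ∧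
                  ∀ β : Idx n → ℝ,
                    l2 ((Matrix.of fun (i : Fin p) (j : Idx n) => psi n Δ j (Y i)).mulVec β -
                        fun i : Fin p => f (Y i + x₀)) ≤ Real.sqrt p * κ'ef * Δ ^ 3 →
                      l1 (fun q : QIdx n => αstar (Sum.inl q)) ≤
                        l1 (fun q : QIdx n => β (Sum.inl q))) →
                FullyQuadraticOn f (fun x => ∑ ι, αstar ι * psi n Δ ι (x - x₀)) x₀ Δ
                  κef κeg κeh} := by
  have hKK : 0 < KK := by norm_num [KK]
  refine ⟨16 * KK * 4000, by positivity, 1, one_pos, ?_⟩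
  intro n hn h hh hh2 κ'ef κ'eg κ'eh h1 h2 h3
  refine ⟨κ'ef + Fintype.card (Idx n) * (24 * κ'ef), by positivity,
    κ'eg + n * (Fintype.card (Idx n) * (56 * κ'ef)), by positivity,
    κ'eh + n * (n * (Fintype.card (Idx n) * (56 * κ'ef))), by positivity, ?_⟩
  rintro Δ hΔ x₀ f _ ⟨α', hsp, hfq⟩ p hp
  have := mu_prob n hΔ
  have hnum := numeric_bound hn hh hp
  have hge := good_event (n := n) hΔ p (800 * (h + n + 1))
  have hp0 : 0 < p := by
    rcases Nat.eq_zero_or_pos p with h0 | h0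
    · exfalso
      subst h0
      have hnR : (2 : ℝ) ≤ n := by exact_mod_cast hn
      have hhR : (1 : ℝ) ≤ h := by exact_mod_cast hh
      have hq2 : 2 ≤ (n + 1) * (n + 2) / 2 := by
        rw [Nat.le_div_iff_mul_le (by norm_num)]
        nlinarith
      have hq : 0 < Real.log ((n + 1) * (n + 2) / 2 : ℕ) :=
        Real.log_pos (by exact_mod_cast hq2)
      have hs : 0 < Real.log ((h : ℝ) + n + 1) := Real.log_pos (by linarith)
      have hpos : 0 < 9 * (16 * KK * 4000) * ((h : ℝ) + n + 1) * Real.log ((h : ℝ) + n + 1) ^ 2 *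
            Real.log ((n + 1) * (n + 2) / 2 : ℕ) := by positivity
      have hz : ((0 : ℕ) : ℝ) / Real.log ((0 : ℕ) : ℝ) = 0 := by simp
      rw [hz] at hp
      exact absurd hp (not_le.mpr hpos)
    · exact h0
  refine (ENNReal.ofReal_le_ofReal ((sub_le_sub_left hnum 1).trans hge)).trans ?_
  rw [ofReal_measureReal]
  apply measure_mono
  rintro Y ⟨hY, hnet⟩ αs ⟨hfeas, hmin⟩
  exact fq_transfer hΔ f x₀ α' αs h1 hfq
    (recovery hΔ x₀ f h1 hp0 α' αs hsp hfq Y hY hnet hfeas hmin)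
end

section
/- Let Δ > 0, n ≥ 1, H ∈ ℝ^{n×n} a symmetric matrix, g ∈ ℝ^n, and c ∈ ℝ, and let m(x) = (1/2)xᵀHx + gᵀx + c. Then m admits the expansion m = Σ_ι α_ι ψ_ι in the basis ψ with coefficients α_{2,ij} = (Δ²/3)·H_{ij} for 1 ≤ i < j ≤ n, α_{2,i} = (Δ²/(3√5))·H_{ii} for 1 ≤ i ≤ n, α_{1,i} = (Δ/√3)·g_i for 1 ≤ i ≤ n, and α_0 = c + (Δ²/6)·Σ_{i=1}^n H_{ii}. Consequently, the number of nonzero coefficients among the quadratic-part coefficients {α_{2,i}, α_{2,ij}} equals the number of nonzero entries of H on or above the diagonal; in particular, if H has at most h nonzero entries on or above the diagonal, then the quadratic-part coefficient vector α_Q of m in the basis ψ is h-sparse. -/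
open Matrix BigOperators MeasureTheory

/-- The coefficients, in the basis `ψ`, of the quadratic `x ↦ (1/2)xᵀHx + gᵀx + c`:
`α_{2,ij} = (Δ²/3)H_{ij}` for `i < j`, `α_{2,i} = (Δ²/(3√5))H_{ii}`, `α_{1,i} = (Δ/√3)g_i`,
and `α_0 = c + (Δ²/6)·Σ_i H_{ii}`. -/
noncomputable def quadCoeff {n : ℕ} (Δ : ℝ) (H : Matrix (Fin n) (Fin n) ℝ) (g : Fin n → ℝ)
    (c : ℝ) : Idx n → ℝ :=
  Sum.elim
    (Sum.elim (fun i => Δ ^ 2 / (3 * Real.sqrt 5) * H i i)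
      (fun p => Δ ^ 2 / 3 * H p.1.1 p.1.2))
    (Sum.elim (fun i => Δ / Real.sqrt 3 * g i) (fun _ => c + Δ ^ 2 / 6 * ∑ i, H i i))

/-- For a symmetric `H`, the quadratic `m(x) = (1/2)xᵀHx + gᵀx + c` expands in
the basis `ψ` with the coefficients `quadCoeff Δ H g c`; the number of nonzero quadratic-part
coefficients equals the number of nonzero entries of `H` on or above the diagonal, and in
particular if the latter is at most `h` then the quadratic part `α_Q` is `h`-sparse. -/
theorem quadratic_expansion_in_psi (n : ℕ) (hn : 1 ≤ n) (Δ : ℝ) (hΔ : 0 < Δ)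
    (H : Matrix (Fin n) (Fin n) ℝ) (hH : H.IsSymm) (g : Fin n → ℝ) (c : ℝ) :
    (∀ x : Fin n → ℝ,
      (1 / 2) * (∑ i, ∑ j, x i * H i j * x j) + (∑ i, g i * x i) + c =
        ∑ ι, quadCoeff Δ H g c ι * psi n Δ ι x) ∧
    card' (fun q : QIdx n => quadCoeff Δ H g c (Sum.inl q)) =
      Nat.card {p : Fin n × Fin n // p.1 ≤ p.2 ∧ H p.1 p.2 ≠ 0} ∧
    (∀ h : ℕ, Nat.card {p : Fin n × Fin n // p.1 ≤ p.2 ∧ H p.1 p.2 ≠ 0} ≤ h →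
      Sparse h (fun q : QIdx n => quadCoeff Δ H g c (Sum.inl q))) := by
  have hcard : card' (fun q : QIdx n => quadCoeff Δ H g c (Sum.inl q)) =
      Nat.card {p : Fin n × Fin n // p.1 ≤ p.2 ∧ H p.1 p.2 ≠ 0} := by
    unfold card'
    have hD : Δ ≠ 0 := hΔ.ne'
    have h5 : Real.sqrt 5 ≠ 0 := by positivity
    let f : QIdx n → Fin n × Fin n := Sum.elim (fun i => (i, i)) (fun p => p.1)
    have hf : ∀ q, (f q).1 ≤ (f q).2 := by
      rintro (i | p)
      · exact le_refl i
      · exact p.2.le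
    have hne : ∀ q : QIdx n, quadCoeff Δ H g c (Sum.inl q) ≠ 0 ↔ H (f q).1 (f q).2 ≠ 0 := by
      rintro (i | p) <;> simp [quadCoeff, f, hD, h5]
    refine Nat.card_eq_of_bijective
      (fun q => ⟨f q.1, hf q.1, (hne q.1).1 q.2⟩) ⟨?_, ?_⟩
    · rintro ⟨q, hq⟩ ⟨r, hr⟩ h
      have h' : f q = f r := congrArg Subtype.val h
      apply Subtype.ext
      change q = r
      rcases q with i | ⟨⟨a, b⟩, hab⟩ <;> rcases r with j | ⟨⟨a', b'⟩, hab'⟩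
      · have := congrArg Prod.fst h'
        exact congrArg Sum.inl this
      · have h1 := congrArg Prod.fst h'
        have h2 := congrArg Prod.snd h'
        simp [f] at h1 h2 hab'
        exact absurd hab' (by rw [← h1, ← h2]; exact lt_irrefl _)
      · have h1 := congrArg Prod.fst h'
        have h2 := congrArg Prod.snd h'
        simp [f] at h1 h2 hab
        exact absurd hab (by rw [h1, h2]; exact lt_irrefl _)
      · exact congrArg Sum.inr (Subtype.ext h')
    · rintro ⟨⟨a, b⟩, hab, hH0⟩
      rcases eq_or_lt_of_le hab with h | h
      · have h : a = b := h
        subst h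
        exact ⟨⟨Sum.inl a, (hne _).2 hH0⟩, rfl⟩
      · exact ⟨⟨Sum.inr ⟨(a, b), h⟩, (hne _).2 hH0⟩, rfl⟩
  refine ⟨?_, hcard, fun h hh => ?_⟩
  · intro x
    have hD : Δ ≠ 0 := hΔ.ne'
    have h5 : Real.sqrt 5 ≠ 0 := by positivity
    have h3 : Real.sqrt 3 ≠ 0 := by positivity
    have key : ∑ i, ∑ j, x i * H i j * x j =
        ∑ i, H i i * x i ^ 2 + 2 * ∑ p : Pairs n, H p.1.1 p.1.2 * (x p.1.1 * x p.1.2) := by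
      have e0 : ∑ p : Pairs n, H p.1.1 p.1.2 * (x p.1.1 * x p.1.2) =
          ∑ i, ∑ j, if i < j then H i j * (x i * x j) else 0 := by
        rw [← Fintype.sum_prod_type'
          (f := fun i j : Fin n => if i < j then H i j * (x i * x j) else 0),
          ← Finset.sum_filter]
        exact (Finset.sum_subtype (p := fun p : Fin n × Fin n => p.1 < p.2) _ (by simp)
          (fun p : Fin n × Fin n => H p.1 p.2 * (x p.1 * x p.2))).symm
      have e1 : ∑ i, ∑ j, (if i < j then H i j * (x i * x j) else 0) =
          ∑ i, ∑ j, if j < i then H i j * (x i * x j) else 0 := by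
        rw [Finset.sum_comm]
        refine Finset.sum_congr rfl fun i _ => Finset.sum_congr rfl fun j _ => ?_
        rw [hH.apply i j, mul_comm (x i)]
      have e2 : ∑ i, H i i * x i ^ 2 =
          ∑ i, ∑ j, if i = j then H i j * (x i * x j) else 0 := by
        refine Finset.sum_congr rfl fun i _ => ?_
        simp [pow_two]
      rw [two_mul, e0]
      nth_rewrite 2 [e1]
      rw [e2]
      simp only [← Finset.sum_add_distrib]
      refine Finset.sum_congr rfl fun i _ => Finset.sum_congr rfl fun j _ => ?_
      rcases lt_trichotomy i j with h | h | h
      · simp [h, h.ne, h.not_gt]; ring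
      · subst h; simp; ring
      · simp [h, h.ne', h.not_gt]; ring
    rw [key]
    simp only [Fintype.sum_sum_type, quadCoeff, psi, Sum.elim_inl, Sum.elim_inr,
      Finset.univ_unique, Finset.sum_singleton]
    have a1 : ∑ i, Δ ^ 2 / (3 * Real.sqrt 5) * H i i *
        (3 * Real.sqrt 5 / (2 * Δ ^ 2) * x i ^ 2 - Real.sqrt 5 / 2) =
        1 / 2 * ∑ i, H i i * x i ^ 2 - Δ ^ 2 / 6 * ∑ i, H i i := by
      rw [Finset.mul_sum, Finset.mul_sum, ← Finset.sum_sub_distrib]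
      refine Finset.sum_congr rfl fun i _ => ?_
      field_simp
      ring
    have a2 : ∑ p : Pairs n, Δ ^ 2 / 3 * H p.1.1 p.1.2 * (3 / Δ ^ 2 * (x p.1.1 * x p.1.2)) =
        ∑ p : Pairs n, H p.1.1 p.1.2 * (x p.1.1 * x p.1.2) := by
      refine Finset.sum_congr rfl fun i _ => ?_
      field_simp
    have a3 : ∑ i, Δ / Real.sqrt 3 * g i * (Real.sqrt 3 / Δ * x i) = ∑ i, g i * x i := by
      refine Finset.sum_congr rfl fun i _ => ?_
      field_simp
    rw [a1, a2, a3]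
    ring
  · unfold Sparse
    rw [hcard]
    exact hh
end
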